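/- arXiv:2007.12754 — 3 statements merged into one kernel-verified Lean document; each statement's English description precedes it below -/
import Mathlib

section
/- Let A ∈ ℝ^{n×n} be SPD, M ∈ ℝ^{n×n} nonsingular with M + Mᵀ − A SPD, P ∈ ℝ^{n×n_c} of full column rank, A_c := PᵀAP, B_c ∈ ℝ^{n_c×n_c} SPD, and let E_ITG = (I−M^{-T}A)(I−P B_c^{-1}PᵀA)(I−M^{-1}A). Set M̃ := Mᵀ(M+Mᵀ−A)^{-1}M, Π_M̃ := P(PᵀM̃P)^{-1}PᵀM̃, K_TG := max_{v≠0} ‖(I−Π_M̃)v‖²_M̃/‖v‖²_A, d₁ := 1/(1+λ_max((PᵀM̃P)^{-1}(B_c−A_c))), d₂ := 1/(1+λ_min((PᵀM̃P)^{-1}(B_c−A_c))). If d₂ ≤ 1, then L₁ ≤ ‖E_ITG‖_A ≤ U₁, where L₁ = 1 − 1/max{K_TG, λ_max(A^{-1}M̃) − d₂λ_max(A^{-1}M̃Π_M̃) + d₂} and U₁ = 1 − 1/(d₁K_TG + (1−d₁)λ_max(A^{-1}M̃)). -/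
open Matrix

/-- Energy norm induced by a matrix `G`: `‖v‖_G = ⟨G v, v⟩^{1/2}`. -/
noncomputable def enorm {m : Type*} [Fintype m] (G : Matrix m m ℝ) (v : m → ℝ) : ℝ :=
  Real.sqrt (v ⬝ᵥ (G *ᵥ v))

/-- The quadratic form of a square matrix. -/
noncomputable def quad {m : Type*} [Fintype m] (G : Matrix m m ℝ) (v : m → ℝ) : ℝ :=
  v ⬝ᵥ (G *ᵥ v)

section QuadraticForms

variable {m k : Type*} [Fintype m] [Fintype k]

lemma quad_add (G H : Matrix m m ℝ) (v : m → ℝ) : quad (G + H) v = quad G v + quad H v := by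
  simp [quad, add_mulVec, dotProduct_add]

lemma quad_sub (G H : Matrix m m ℝ) (v : m → ℝ) : quad (G - H) v = quad G v - quad H v := by
  simp [quad, sub_mulVec, dotProduct_sub]

lemma quad_smul (a : ℝ) (G : Matrix m m ℝ) (v : m → ℝ) : quad (a • G) v = a * quad G v := by
  simp [quad, smul_mulVec]

lemma quad_mulVec (G : Matrix k k ℝ) (L : Matrix k m ℝ) (v : m → ℝ) :
    quad G (L *ᵥ v) = quad (Lᵀ * G * L) v := by
  simp only [quad, ← mulVec_mulVec]
  rw [dotProduct_mulVec v Lᵀ, vecMul_transpose]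

lemma quad_nonneg {G : Matrix m m ℝ} (hG : G.PosSemidef) (v : m → ℝ) : 0 ≤ quad G v := by
  simpa [quad] using hG.dotProduct_mulVec_nonneg v

lemma quad_pos {G : Matrix m m ℝ} (hG : G.PosDef) {v : m → ℝ} (hv : v ≠ 0) : 0 < quad G v := by
  simpa [quad] using hG.dotProduct_mulVec_pos hv

omit [Fintype m] in
lemma transpose_eq_of_isHermitian {G : Matrix m m ℝ} (hG : G.IsHermitian) : Gᵀ = G := by
  simpa [conjTranspose_eq_transpose_of_trivial] using hG.eq

omit [Fintype m] in
lemma isHermitian_of_transpose_eq {G : Matrix m m ℝ} (hG : Gᵀ = G) : G.IsHermitian := by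
  rw [IsHermitian, conjTranspose_eq_transpose_of_trivial, hG]

lemma posSemidef_of_quad_nonneg {G : Matrix m m ℝ} (hG : Gᵀ = G) (h : ∀ v, 0 ≤ quad G v) :
    G.PosSemidef :=
  .of_dotProduct_mulVec_nonneg (isHermitian_of_transpose_eq hG) (by simpa [quad] using h)

lemma enorm_sq {G : Matrix m m ℝ} (hG : G.PosSemidef) (v : m → ℝ) : enorm G v ^ 2 = quad G v :=
  Real.sq_sqrt (quad_nonneg hG v)

/-- Cauchy–Schwarz inequality for a positive semidefinite matrix. -/
lemma sq_dotProduct_mulVec_le {G : Matrix m m ℝ} (hG : G.PosSemidef) (a b : m → ℝ) :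
    (a ⬝ᵥ (G *ᵥ b)) ^ 2 ≤ quad G a * quad G b := by
  have hsymm : b ⬝ᵥ (G *ᵥ a) = a ⬝ᵥ (G *ᵥ b) := by
    rw [dotProduct_mulVec, ← mulVec_transpose, transpose_eq_of_isHermitian hG.1, dotProduct_comm]
  have h := discrim_le_zero (a := quad G a) (b := 2 * (a ⬝ᵥ (G *ᵥ b))) (c := quad G b) fun t => by
    have := quad_nonneg hG (t • a + b)
    simp only [quad, mulVec_add, mulVec_smul, dotProduct_add, add_dotProduct, smul_dotProduct,
      dotProduct_smul, smul_eq_mul, hsymm] at this ⊢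
    linarith
  rw [discrim] at h
  linarith

variable [DecidableEq m]

/-- A bound for an operator between two energy spaces passes to its adjoint. -/
lemma quad_inv_transpose_le [DecidableEq k] {G : Matrix m m ℝ} {H : Matrix k k ℝ} (hG : G.PosDef) (hH : H.PosDef)
    {L : Matrix k m ℝ} {μ : ℝ} (hμ : 0 ≤ μ) (h : ∀ x, quad H (L *ᵥ x) ≤ μ * quad G x)
    (y : k → ℝ) : quad G⁻¹ (Lᵀ *ᵥ y) ≤ μ * quad H⁻¹ y := by
  have hG' := (isUnit_iff_isUnit_det _).1 hG.isUnit
  have hH' := (isUnit_iff_isUnit_det _).1 hH.isUnit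
  set x := G⁻¹ *ᵥ (Lᵀ *ᵥ y) with hx
  have hGx : quad G x = quad G⁻¹ (Lᵀ *ᵥ y) := by
    rw [hx, quad_mulVec, transpose_eq_of_isHermitian hG.inv.1, nonsing_inv_mul _ hG', one_mul]
  have hcs := sq_dotProduct_mulVec_le hH.posSemidef (H⁻¹ *ᵥ y) (L *ᵥ x)
  have hleft : (H⁻¹ *ᵥ y) ⬝ᵥ (H *ᵥ (L *ᵥ x)) = quad G⁻¹ (Lᵀ *ᵥ y) := by
    rw [dotProduct_mulVec, ← mulVec_transpose, transpose_eq_of_isHermitian hH.1, mulVec_mulVec,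
      mul_nonsing_inv _ hH', one_mulVec, dotProduct_mulVec, ← mulVec_transpose]
    rfl
  have hy : quad H (H⁻¹ *ᵥ y) = quad H⁻¹ y := by
    rw [quad_mulVec, transpose_eq_of_isHermitian hH.inv.1, nonsing_inv_mul _ hH', one_mul]
  rw [hleft, hy] at hcs
  have hLx := h x
  rw [hGx] at hLx
  have h0 := quad_nonneg hG.inv.posSemidef (Lᵀ *ᵥ y)
  have h1 := quad_nonneg hH.inv.posSemidef y
  rcases h0.eq_or_lt with h0 | h0
  · rw [← h0]; positivity
  · have := hcs.trans (mul_le_mul_of_nonneg_left hLx h1)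
    nlinarith

/-- Inversion reverses the Loewner order. -/
lemma quad_inv_le_quad_inv {G H : Matrix m m ℝ} (hG : G.PosDef) (hH : H.PosDef) {μ : ℝ}
    (hμ : 0 ≤ μ) (h : ∀ x, quad H x ≤ μ * quad G x) (y : m → ℝ) :
    quad G⁻¹ y ≤ μ * quad H⁻¹ y := by
  simpa using quad_inv_transpose_le hG hH (L := 1) hμ (by simpa using h) y

lemma quad_le_of_spectrum_le {G F : Matrix m m ℝ} (hG : G.PosDef) (hF : Fᵀ = F) {l : ℝ}
    (hl : l ∈ upperBounds (spectrum ℝ (G⁻¹ * F))) (v : m → ℝ) : quad F v ≤ l * quad G v := by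
  open scoped MatrixOrder in
  obtain ⟨R, hR, rfl⟩ := CStarAlgebra.isStrictlyPositive_iff_eq_star_mul_self.1
    (isStrictlyPositive_iff_posDef.2 hG)
  have hR' := (isUnit_iff_isUnit_det _).1 hR
  have hRt : IsUnit Rᵀ.det := by rwa [det_transpose]
  rw [star_eq_conjTranspose, conjTranspose_eq_transpose_of_trivial] at *
  set T := R⁻¹ᵀ * F * R⁻¹ with hT
  have hTF : Rᵀ * T * R = F := by
    rw [hT, transpose_nonsing_inv]
    simp only [← Matrix.mul_assoc, mul_nonsing_inv _ hRt, Matrix.one_mul]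
    rw [Matrix.mul_assoc, nonsing_inv_mul _ hR', Matrix.mul_one]
  have hTt : Tᵀ = T := by
    simp only [hT, transpose_mul, hF, transpose_transpose, Matrix.mul_assoc]
  have hspec : spectrum ℝ ((Rᵀ * R)⁻¹ * F) = spectrum ℝ T := by
    obtain ⟨u, rfl⟩ := hR
    rw [← spectrum.units_conjugate (a := ((u : Matrix m m ℝ)ᵀ * u)⁻¹ * F) (u := u), hT,
      coe_units_inv, Matrix.mul_inv_rev, transpose_nonsing_inv]
    simp only [← Matrix.mul_assoc, mul_nonsing_inv _ hR', Matrix.one_mul]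
  rw [hspec] at hl
  have hD : (algebraMap ℝ (Matrix m m ℝ) l - T).IsHermitian := by
    apply isHermitian_of_transpose_eq
    rw [transpose_sub, hTt, Algebra.algebraMap_eq_smul_one, transpose_smul, transpose_one]
  have hpsd : (algebraMap ℝ (Matrix m m ℝ) l - T).PosSemidef := by
    rw [hD.posSemidef_iff_eigenvalues_nonneg]
    intro i
    have hi := hD.eigenvalues_mem_spectrum_real i
    rw [← spectrum.singleton_sub_eq] at hi
    obtain ⟨_, rfl, t, ht, hti⟩ := Set.mem_sub.1 hi
    have := hl ht
    simp only [Pi.zero_apply]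
    linarith
  have := quad_nonneg hpsd (R *ᵥ v)
  rw [Algebra.algebraMap_eq_smul_one, quad_sub, quad_smul, quad_mulVec, quad_mulVec, hTF,
    Matrix.mul_one] at this
  linarith

lemma le_quad_of_le_spectrum {G F : Matrix m m ℝ} (hG : G.PosDef) (hF : Fᵀ = F) {l : ℝ}
    (hl : l ∈ lowerBounds (spectrum ℝ (G⁻¹ * F))) (v : m → ℝ) : l * quad G v ≤ quad F v := by
  have h := quad_le_of_spectrum_le (F := -F) (l := -l) hG (by rw [transpose_neg, hF])
    (fun t ht => by
      rw [Matrix.mul_neg, ← spectrum.neg_eq, Set.mem_neg] at ht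
      linarith [hl ht]) v
  have : quad (-F) v = -quad F v := by simp [quad, neg_mulVec]
  linarith

lemma exists_quad_eq_of_mem_spectrum {G F : Matrix m m ℝ} (hG : G.PosDef) {l : ℝ}
    (hl : l ∈ spectrum ℝ (G⁻¹ * F)) : ∃ v ≠ 0, quad F v = l * quad G v := by
  have hG' := (isUnit_iff_isUnit_det _).1 hG.isUnit
  rw [spectrum.mem_iff, isUnit_iff_isUnit_det, isUnit_iff_ne_zero, not_not,
    ← exists_mulVec_eq_zero_iff] at hl
  obtain ⟨v, hv, h⟩ := hl
  refine ⟨v, hv, ?_⟩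
  rw [sub_mulVec, Algebra.algebraMap_eq_smul_one, smul_mulVec, one_mulVec, sub_eq_zero] at h
  have := congrArg (G *ᵥ ·) h
  simp only [mulVec_smul, mulVec_mulVec, ← Matrix.mul_assoc, mul_nonsing_inv _ hG',
    Matrix.one_mul] at this
  rw [quad, ← this, dotProduct_smul, smul_eq_mul, quad]

end QuadraticForms

section RingIdentities

variable {R : Type*} [Ring R] {a ai m mi t ti n ni p q : R}

lemma smoother_mul_inv_mul_adjoint (hn : n = m + t - a) (ha : a * ai = 1) (ha' : ai * a = 1)
    (hm : mi * m = 1) (ht : t * ti = 1) :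
    (1 - mi * a) * ai * (1 - a * ti) = ai - mi * n * ti := by
  have e : (1 - mi * a) * ai * (1 - a * ti)
      = ai - ai * a * ti - mi * (a * ai) + mi * (a * ai) * a * ti := by noncomm_ring
  have e' : mi * n * ti = mi * m * ti + mi * (t * ti) - mi * a * ti := by
    rw [hn]; noncomm_ring
  rw [e, e', ha, ha', hm, ht]
  noncomm_ring

lemma coarse_mul_smoothed_eq (hn : n = m + t - a) (hni : n * ni = 1) (hni' : ni * n = 1) :
    (m - a) * ni * (t - a) = t * ni * m - a := by
  have h1 : m - a = n - t := by rw [hn]; abel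
  have h2 : t - a = n - m := by rw [hn]; abel
  have e : (n - t) * ni * (n - m) = n * ni * n - n * ni * m - t * (ni * n) + t * ni * m := by
    noncomm_ring
  rw [h1, h2, e, hni, hni', hn]
  noncomm_ring

lemma inv_sub_iteration_mul_inv (hn : n = m + t - a) (ha : a * ai = 1) (hm : m * mi = 1)
    (ht : ti * t = 1) :
    ai - (1 - ti * a) * (1 - p * a) * (1 - mi * a) * ai
      = ti * (n + (t - a) * p * (m - a)) * mi := by
  have e : ai - (1 - ti * a) * (1 - p * a) * (1 - mi * a) * ai
      = ti * (a * ai) + mi * (a * ai) - ti * a * mi * (a * ai)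
        + (1 - ti * a) * p * ((a * ai) - a * mi * (a * ai)) := by noncomm_ring
  have e' : ti * (n + (t - a) * p * (m - a)) * mi
      = ti * (m * mi) + ti * t * mi - ti * a * mi + (ti * t - ti * a) * p * (m * mi - a * mi) := by
    rw [hn]; noncomm_ring
  rw [e, e', ha, hm, ht]
  noncomm_ring

lemma woodbury_factor (hn : n = m + t - a) (hni : n * ni = 1) (hni' : ni * n = 1)
    (hm : m * mi = 1) (ht : ti * t = 1) :
    a + (1 - a * ti) * (t * ni * m) * (1 - mi * a)
        - (1 - a * ti) * (t * ni * m) * q * (t * ni * m) * (1 - mi * a)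
      = m * (ni - ni * (t - a) * q * (m - a) * ni) * t := by
  have h1 : m - a = n - t := by rw [hn]; abel
  have h2 : t - a = n - m := by rw [hn]; abel
  have l : (1 - a * ti) * (t * ni * m) = m * ni * (t - a) := by
    have e : (1 - a * ti) * (t * ni * m) = (t - a * (ti * t)) * ni * m := by noncomm_ring
    have e1 : (n - m) * ni * m = n * ni * m - m * ni * m := by noncomm_ring
    have e2 : m * ni * (n - m) = m * (ni * n) - m * ni * m := by noncomm_ring
    rw [e, ht, mul_one, h2, e1, e2, hni, hni']
    noncomm_ring
  have r : t * ni * m * (1 - mi * a) = (m - a) * ni * t := by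
    have e : t * ni * m * (1 - mi * a) = t * ni * (m - m * mi * a) := by noncomm_ring
    have e1 : t * ni * (n - t) = t * (ni * n) - t * ni * t := by noncomm_ring
    have e2 : (n - t) * ni * t = n * ni * t - t * ni * t := by noncomm_ring
    rw [e, hm, one_mul, h1, e1, e2, hni, hni']
    noncomm_ring
  have c : a + (1 - a * ti) * (t * ni * m) * (1 - mi * a) = m * ni * t := by
    have e : (1 - a * ti) * (t * ni * m) * (1 - mi * a)
        = (t - a * (ti * t)) * ni * (m - m * mi * a) := by noncomm_ring
    have e1 : (n - m) * ni * (n - t) = n * ni * n - n * ni * t - m * (ni * n) + m * ni * t := by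
      noncomm_ring
    rw [e, ht, hm, mul_one, one_mul, h1, h2, e1, hni, hni', hn]
    noncomm_ring
  rw [c, l, mul_assoc (m * ni * (t - a) * q), r]
  noncomm_ring

lemma woodbury_mul_eq_one (hn : n = m + t - a) (hni : n * ni = 1) (hni' : ni * n = 1)
    (ha : a * ai = 1) (hm : m * mi = 1) (ht : ti * t = 1) (ht' : t * ti = 1)
    (hpq : q * (t * ni * m - a) * p = p - q) :
    (a + (1 - a * ti) * (t * ni * m) * (1 - mi * a)
        - (1 - a * ti) * (t * ni * m) * q * (t * ni * m) * (1 - mi * a))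
      * (ai - (1 - ti * a) * (1 - p * a) * (1 - mi * a) * ai) = 1 := by
  rw [woodbury_factor hn hni hni' hm ht, inv_sub_iteration_mul_inv hn ha hm ht]
  rw [← coarse_mul_smoothed_eq hn hni hni'] at hpq
  set g := m - a
  set f := t - a
  have e : m * (ni - ni * f * q * g * ni) * t * (ti * (n + f * p * g) * mi)
      = m * (ni - ni * f * q * g * ni) * (t * ti) * (n + f * p * g) * mi := by noncomm_ring
  have e' : m * (ni - ni * f * q * g * ni) * (n + f * p * g) * mi
      = m * (ni * n) * mi + m * ni * f * (p - q * (g * ni * f) * p - q) * g * mi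
        - m * ni * f * q * g * (ni * n - 1) * mi := by noncomm_ring
  rw [e, ht', mul_one, e', hpq, hni']
  simp [hm]

end RingIdentities

section Smoother

variable {m : Type*} [Fintype m] [DecidableEq m] {A T S L : Matrix m m ℝ}

/-- If `S A⁻¹ Sᵀ = A⁻¹ - T⁻¹`, then the energy of `T` dominates that of `A`. -/
lemma quad_le_quad_of_smoother (hA : A.PosDef) (hT : T.PosDef)
    (hS : S * A⁻¹ * Sᵀ = A⁻¹ - T⁻¹) (v : m → ℝ) : quad A v ≤ quad T v := by
  have h := quad_inv_le_quad_inv (μ := 1) hA.inv hT.inv zero_le_one (fun x => by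
    have := quad_nonneg hA.inv.posSemidef (Sᵀ *ᵥ x)
    rw [quad_mulVec, transpose_transpose, hS, quad_sub] at this
    linarith) v
  rw [nonsing_inv_nonsing_inv _ ((isUnit_iff_isUnit_det _).1 hA.isUnit),
    nonsing_inv_nonsing_inv _ ((isUnit_iff_isUnit_det _).1 hT.isUnit)] at h
  linarith

/-- Converse of `quad_inv_transpose_le`. -/
lemma quad_mulVec_le_of_adjoint (hA : A.PosDef) (hT : T.PosDef) {μ : ℝ} (hμ : 0 ≤ μ)
    (h : ∀ y, quad A⁻¹ (Lᵀ *ᵥ y) ≤ μ * quad T⁻¹ y) (x : m → ℝ) :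
    quad T (L *ᵥ x) ≤ μ * quad A x := by
  have h' := quad_inv_transpose_le hT.inv hA.inv hμ h x
  rwa [nonsing_inv_nonsing_inv _ ((isUnit_iff_isUnit_det _).1 hA.isUnit),
    nonsing_inv_nonsing_inv _ ((isUnit_iff_isUnit_det _).1 hT.isUnit), transpose_transpose] at h'

lemma quad_inv_transpose_le_of_projection (hT : T.PosDef) (hLL : L * L = L)
    (hTL : (T * L)ᵀ = T * L) (y : m → ℝ) : quad T⁻¹ (Lᵀ *ᵥ y) ≤ quad T⁻¹ y := by
  have hT' := (isUnit_iff_isUnit_det _).1 hT.isUnit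
  rw [transpose_mul, transpose_eq_of_isHermitian hT.1] at hTL
  have hcomm : T⁻¹ * Lᵀ = L * T⁻¹ := by
    calc T⁻¹ * Lᵀ = T⁻¹ * (Lᵀ * T) * T⁻¹ := by
          rw [Matrix.mul_assoc, Matrix.mul_assoc, mul_nonsing_inv _ hT', Matrix.mul_one]
      _ = L * T⁻¹ := by
          rw [hTL, ← Matrix.mul_assoc, nonsing_inv_mul _ hT', Matrix.one_mul]
  have hL : L * T⁻¹ * Lᵀ = L * T⁻¹ := by
    rw [Matrix.mul_assoc, hcomm, ← Matrix.mul_assoc, hLL]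
  have h := quad_nonneg hT.inv.posSemidef ((1 - Lᵀ) *ᵥ y)
  have e : (1 - Lᵀ)ᵀ * T⁻¹ * (1 - Lᵀ) = T⁻¹ - L * T⁻¹ := by
    simp only [transpose_sub, transpose_one, transpose_transpose, Matrix.mul_sub, Matrix.sub_mul,
      Matrix.one_mul, Matrix.mul_one, hL, hcomm]
    abel
  rw [quad_mulVec, e, quad_sub] at h
  rw [quad_mulVec, transpose_transpose, hL]
  linarith

lemma one_le_of_projection (hA : A.PosDef) (hT : T.PosDef) (hS : S * A⁻¹ * Sᵀ = A⁻¹ - T⁻¹)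
    (hLL : L * L = L) (hL0 : L ≠ 0) {κ : ℝ} (h : ∀ v, quad T (L *ᵥ v) ≤ κ * quad A v) :
    1 ≤ κ := by
  obtain ⟨x, hx⟩ : ∃ x, L *ᵥ x ≠ 0 := by
    by_contra! hL
    refine hL0 (ext fun i j => ?_)
    simpa using congrFun (hL (Pi.single j 1)) i
  have h1 := h (L *ᵥ x)
  rw [mulVec_mulVec, hLL] at h1
  have h2 := quad_le_quad_of_smoother hA hT hS (L *ᵥ x)
  have h3 := quad_pos hA hx
  by_contra! hκ
  nlinarith

/-- Composing a `T`-orthogonal projection with the smoother lowers its squared norm by one. -/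
lemma quad_smoothed_le (hA : A.PosDef) (hT : T.PosDef) (hS : S * A⁻¹ * Sᵀ = A⁻¹ - T⁻¹)
    (hLL : L * L = L) (hTL : (T * L)ᵀ = T * L) (hL0 : L ≠ 0) {κ : ℝ}
    (h : ∀ v, quad T (L *ᵥ v) ≤ κ * quad A v) (x : m → ℝ) :
    quad T (L *ᵥ (S *ᵥ x)) ≤ (κ - 1) * quad A x := by
  have hκ := one_le_of_projection hA hT hS hLL hL0 h
  rw [mulVec_mulVec]
  refine quad_mulVec_le_of_adjoint hA hT (by linarith) (fun y => ?_) x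
  have h1 := quad_inv_transpose_le hA hT (by linarith) h (Lᵀ *ᵥ y)
  rw [mulVec_mulVec, ← transpose_mul, hLL] at h1
  have h2 := quad_inv_transpose_le_of_projection hT hLL hTL y
  rw [transpose_mul, ← mulVec_mulVec, quad_mulVec _ Sᵀ, transpose_transpose, hS, quad_sub]
  nlinarith

lemma quad_le_of_quad_smoothed_le (hA : A.PosDef) (hT : T.PosDef)
    (hS : S * A⁻¹ * Sᵀ = A⁻¹ - T⁻¹) (hLL : L * L = L) (hTL : (T * L)ᵀ = T * L) {κ : ℝ}
    (hκ : 1 ≤ κ) (h : ∀ x, quad T (L *ᵥ (S *ᵥ x)) ≤ (κ - 1) * quad A x) (v : m → ℝ) :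
    quad T (L *ᵥ v) ≤ κ * quad A v := by
  refine quad_mulVec_le_of_adjoint hA hT (by linarith) (fun y => ?_) v
  have h1 := quad_inv_transpose_le hA hT (L := L * S) (μ := κ - 1) (by linarith)
    (fun x => by simpa [mulVec_mulVec] using h x) y
  have h2 := quad_inv_transpose_le_of_projection hT hLL hTL y
  rw [transpose_mul, ← mulVec_mulVec, quad_mulVec _ Sᵀ, transpose_transpose, hS, quad_sub] at h1
  linarith

end Smoother

section EnergyNorm

variable {m : Type*} [Fintype m] {A E : Matrix m m ℝ}

/-- The energy norm of an `A`-symmetric matrix bounds its Rayleigh quotients. -/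
lemma quad_mul_le_of_enorm_le (hA : A.PosDef) {l : ℝ}
    (h : ∀ v ≠ 0, enorm A (E *ᵥ v) / enorm A v ≤ l) (v : m → ℝ) :
    quad (A * E) v ≤ l * quad A v := by
  rcases eq_or_ne v 0 with rfl | hv
  · simp [quad]
  have hpos := quad_pos hA hv
  have hsq := enorm_sq hA.posSemidef v
  have hv0 : 0 < enorm A v := Real.sqrt_pos.2 hpos
  have h1 := (div_le_iff₀ hv0).1 (h v hv)
  have h0 : 0 ≤ enorm A (E *ᵥ v) := Real.sqrt_nonneg _
  have hcs := sq_dotProduct_mulVec_le hA.posSemidef v (E *ᵥ v)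
  rw [← enorm_sq hA.posSemidef, ← enorm_sq hA.posSemidef, ← mul_pow, mulVec_mulVec] at hcs
  have h2 := abs_le_of_sq_le_sq hcs (by positivity)
  have h3 : quad (A * E) v ≤ enorm A v * enorm A (E *ᵥ v) := (le_abs_self _).trans h2
  rw [← hsq]
  nlinarith

/-- For an `A`-positive semidefinite matrix, bounded Rayleigh quotients bound the energy norm. -/
lemma enorm_div_le_of_quad_mul_le (hA : A.PosDef) (hE : (A * E).PosSemidef) {l : ℝ}
    (h : ∀ v, quad (A * E) v ≤ l * quad A v) {v : m → ℝ} (hv : v ≠ 0) :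
    enorm A (E *ᵥ v) / enorm A v ≤ l := by
  have hpos := quad_pos hA hv
  have hl : 0 ≤ l := by
    have := (quad_nonneg hE v).trans (h v)
    by_contra! hl
    nlinarith
  have hv0 : 0 < enorm A v := Real.sqrt_pos.2 hpos
  rw [div_le_iff₀ hv0]
  refine le_of_sq_le_sq ?_ (by positivity)
  rw [mul_pow, enorm_sq hA.posSemidef, enorm_sq hA.posSemidef]
  have hcs := sq_dotProduct_mulVec_le hE (E *ᵥ v) v
  rw [← mulVec_mulVec] at hcs
  change quad A (E *ᵥ v) ^ 2 ≤ _ at hcs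
  have h1 := h v
  have h2 := h (E *ᵥ v)
  have h3 := quad_nonneg hA.posSemidef (E *ᵥ v)
  have h4 := quad_nonneg hE v
  have h5 : quad (A * E) (E *ᵥ v) * quad (A * E) v ≤ (l * quad A (E *ᵥ v)) * (l * quad A v) :=
    mul_le_mul h2 h1 h4 (by positivity)
  rcases h3.eq_or_lt with h3 | h3
  · rw [← h3]; positivity
  · nlinarith

end EnergyNorm

section TwoGrid

variable {m k : Type*} [Fintype m] [DecidableEq m] [Fintype k] [DecidableEq k]

/-- With `B` the inverse of the preconditioner `(1 - E) A⁻¹`, bounds for the Rayleigh quotients of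
`E` are bounds for `B` relative to `A`. -/
lemma quad_mul_le_iff {A E B : Matrix m m ℝ} (hA : A.PosDef)
    (hC : (A⁻¹ - E * A⁻¹).PosDef) (hBC : B * (A⁻¹ - E * A⁻¹) = 1) {U : ℝ} (hU : 0 < U) :
    (∀ v, quad (A * E) v ≤ (1 - 1 / U) * quad A v) ↔ ∀ s, quad B s ≤ U * quad A s := by
  set C := A⁻¹ - E * A⁻¹ with hCdef
  have hA' := (isUnit_iff_isUnit_det _).1 hA.isUnit
  have hC' := (isUnit_iff_isUnit_det _).1 hC.isUnit
  have hAt := transpose_eq_of_isHermitian hA.1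
  have hB : C⁻¹ = B := inv_eq_left_inv hBC
  have hACA (v : m → ℝ) : quad C (A *ᵥ v) = quad A v - quad (A * E) v := by
    rw [quad_mulVec, hAt, ← quad_sub, hCdef, Matrix.mul_assoc, Matrix.sub_mul, Matrix.mul_assoc E,
      nonsing_inv_mul _ hA', Matrix.mul_one, Matrix.mul_sub, Matrix.mul_one]
  have hAinv (v : m → ℝ) : quad A⁻¹ (A *ᵥ v) = quad A v := by
    rw [quad_mulVec, hAt, mul_nonsing_inv _ hA', Matrix.one_mul]
  constructor
  · intro h s
    have key := quad_inv_le_quad_inv hC hA.inv hU.le (fun y => by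
      have hy := h (A⁻¹ *ᵥ y)
      have e1 := hACA (A⁻¹ *ᵥ y)
      have e2 := hAinv (A⁻¹ *ᵥ y)
      rw [mulVec_mulVec, mul_nonsing_inv _ hA', one_mulVec] at e1 e2
      have h3 : 1 / U * quad A⁻¹ y ≤ quad C y := by
        rw [e1, e2]; linarith
      rwa [one_div, inv_mul_le_iff₀ hU] at h3) s
    rwa [hB, nonsing_inv_nonsing_inv _ hA'] at key
  · intro h v
    have key := quad_inv_le_quad_inv hA hC.inv hU.le (by rwa [hB]) (A *ᵥ v)
    rw [nonsing_inv_nonsing_inv _ hC', hAinv, hACA] at key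
    have : 1 / U * quad A v ≤ quad A v - quad (A * E) v := by
      rwa [one_div, inv_mul_le_iff₀ hU]
    linarith

lemma preconditioner_posDef {A M : Matrix m m ℝ} {P : Matrix m k ℝ} {Bc : Matrix k k ℝ}
    (hA : A.PosDef) (hM : IsUnit M.det) (hN : (M + Mᵀ - A).PosDef) (hBc : Bc.PosDef) :
    (A⁻¹ - (1 - Mᵀ⁻¹ * A) * (1 - P * Bc⁻¹ * Pᵀ * A) * (1 - M⁻¹ * A) * A⁻¹).PosDef := by
  have hA' := (isUnit_iff_isUnit_det _).1 hA.isUnit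
  have hMt : IsUnit Mᵀ.det := by rwa [det_transpose]
  rw [inv_sub_iteration_mul_inv (n := M + Mᵀ - A) (m := M) (t := Mᵀ) rfl (mul_nonsing_inv _ hA')
    (mul_nonsing_inv _ hM) (nonsing_inv_mul _ hMt)]
  have h1 := hBc.inv.posSemidef.conjTranspose_mul_mul_same (Pᵀ * (M - A))
  have e : (Pᵀ * (M - A))ᴴ * Bc⁻¹ * (Pᵀ * (M - A))
      = (Mᵀ - A) * (P * Bc⁻¹ * Pᵀ) * (M - A) := by
    simp only [conjTranspose_eq_transpose_of_trivial, transpose_mul, transpose_sub,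
      transpose_transpose, transpose_eq_of_isHermitian hA.1, Matrix.mul_assoc]
  rw [e] at h1
  have h2 := (hN.add_posSemidef h1).conjTranspose_mul_mul_same (B := M⁻¹)
    (mulVec_injective_of_isUnit ((isUnit_iff_isUnit_det _).2 (isUnit_nonsing_inv_det _ hM)))
  rwa [conjTranspose_eq_transpose_of_trivial, transpose_nonsing_inv] at h2

lemma iteration_posSemidef {A M : Matrix m m ℝ} {P : Matrix m k ℝ} {Bc : Matrix k k ℝ}
    (hA : A.PosDef) (hBc : Bc.PosDef) (h : ∀ c, quad (Pᵀ * A * P) c ≤ quad Bc c) :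
    (A * ((1 - Mᵀ⁻¹ * A) * (1 - P * Bc⁻¹ * Pᵀ * A) * (1 - M⁻¹ * A))).PosSemidef := by
  have hA' := (isUnit_iff_isUnit_det _).1 hA.isUnit
  have hAt := transpose_eq_of_isHermitian hA.1
  have hcorr : (A - A * (P * Bc⁻¹ * Pᵀ) * A).PosSemidef := by
    refine posSemidef_of_quad_nonneg ?_ fun v => ?_
    · simp only [transpose_sub, transpose_mul, hAt, transpose_transpose,
        transpose_eq_of_isHermitian hBc.inv.1, Matrix.mul_assoc]
    · have h1 := quad_inv_transpose_le hBc hA (L := P) zero_le_one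
        (fun c => by rw [quad_mulVec, one_mul]; exact h c) (A *ᵥ v)
      rw [quad_mulVec A⁻¹, hAt, mul_nonsing_inv _ hA', Matrix.one_mul, one_mul, mulVec_mulVec,
        quad_mulVec] at h1
      have e : (Pᵀ * A)ᵀ * Bc⁻¹ * (Pᵀ * A) = A * (P * Bc⁻¹ * Pᵀ) * A := by
        simp only [transpose_mul, hAt, transpose_transpose, Matrix.mul_assoc]
      rw [e] at h1
      rw [quad_sub]
      linarith
  have h2 := hcorr.conjTranspose_mul_mul_same (1 - M⁻¹ * A)
  convert h2 using 1
  rw [conjTranspose_eq_transpose_of_trivial, transpose_sub, transpose_one, transpose_mul, hAt,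
    transpose_nonsing_inv]
  noncomm_ring

omit [DecidableEq m] in
/-- The coarse correction operator satisfies the resolvent identity. -/
lemma coarse_resolvent {D : Matrix m m ℝ} {P : Matrix m k ℝ} {Bc H : Matrix k k ℝ}
    (hBc : Bc.PosDef) (hH : H.PosDef) (hD : Pᵀ * D * P = H - Bc) :
    P * H⁻¹ * Pᵀ * D * (P * Bc⁻¹ * Pᵀ) = P * Bc⁻¹ * Pᵀ - P * H⁻¹ * Pᵀ := by
  have e : P * H⁻¹ * Pᵀ * D * (P * Bc⁻¹ * Pᵀ) = P * (H⁻¹ * (Pᵀ * D * P) * Bc⁻¹) * Pᵀ := by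
    simp only [Matrix.mul_assoc]
  rw [e, hD, Matrix.mul_sub, Matrix.sub_mul,
    nonsing_inv_mul _ ((isUnit_iff_isUnit_det _).1 hH.isUnit), Matrix.mul_assoc H⁻¹ Bc,
    mul_nonsing_inv _ ((isUnit_iff_isUnit_det _).1 hBc.isUnit), Matrix.one_mul, Matrix.mul_one,
    Matrix.mul_sub, Matrix.sub_mul]

omit [DecidableEq m] in
lemma coarseProjection_mul_self {T : Matrix m m ℝ} {P : Matrix m k ℝ}
    (h : (Pᵀ * T * P).PosDef) :
    P * (Pᵀ * T * P)⁻¹ * Pᵀ * T * P = P := by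
  have h' := (isUnit_iff_isUnit_det _).1 h.isUnit
  have e : P * (Pᵀ * T * P)⁻¹ * Pᵀ * T * P = P * ((Pᵀ * T * P)⁻¹ * (Pᵀ * T * P)) := by
    simp only [Matrix.mul_assoc]
  rw [e, nonsing_inv_mul _ h', Matrix.mul_one]

omit [DecidableEq m] in
lemma mul_coarseProjection_transpose {T : Matrix m m ℝ} {P : Matrix m k ℝ} (hT : Tᵀ = T) :
    (T * (P * (Pᵀ * T * P)⁻¹ * Pᵀ * T))ᵀ = T * (P * (Pᵀ * T * P)⁻¹ * Pᵀ * T) := by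
  simp only [transpose_mul, transpose_nonsing_inv, transpose_transpose, hT, Matrix.mul_assoc]

omit [DecidableEq m] in
lemma quad_projection {T L : Matrix m m ℝ} (hT : Tᵀ = T) (hLL : L * L = L)
    (hTL : (T * L)ᵀ = T * L) (v : m → ℝ) : quad T (L *ᵥ v) = quad (T * L) v := by
  rw [quad_mulVec]
  rw [transpose_mul, hT] at hTL
  rw [hTL, Matrix.mul_assoc, hLL]

lemma quad_add_quad_complement {T L : Matrix m m ℝ} (hT : Tᵀ = T) (hLL : L * L = L)
    (hTL : (T * L)ᵀ = T * L) (v : m → ℝ) :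
    quad T (L *ᵥ v) + quad T ((1 - L) *ᵥ v) = quad T v := by
  have h1 : (1 - L) * (1 - L) = 1 - L := by
    simp [Matrix.mul_sub, Matrix.sub_mul, hLL]
  have h2 : (T * (1 - L))ᵀ = T * (1 - L) := by
    rw [Matrix.mul_sub, Matrix.mul_one, transpose_sub, hTL, hT]
  rw [quad_projection hT hLL hTL, quad_projection hT h1 h2, ← quad_add, ← Matrix.mul_add]
  simp

end TwoGrid

theorem stmt_7 {n nc : ℕ} (hnc : nc < n)
    (A M : Matrix (Fin n) (Fin n) ℝ)
    (P : Matrix (Fin n) (Fin nc) ℝ)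
    (Bc : Matrix (Fin nc) (Fin nc) ℝ)
    (hA : A.PosDef) (hM : IsUnit M.det)
    (hMMA : (M + Mᵀ - A).PosDef)
    (hP : P.rank = nc)
    (hBc : Bc.PosDef)
    (Ac : Matrix (Fin nc) (Fin nc) ℝ) (hAc : Ac = Pᵀ * A * P)
    (E : Matrix (Fin n) (Fin n) ℝ)
    (hE : E = (1 - Mᵀ⁻¹ * A) * (1 - P * Bc⁻¹ * Pᵀ * A) * (1 - M⁻¹ * A))
    (Mtil : Matrix (Fin n) (Fin n) ℝ)
    (hMtil : Mtil = Mᵀ * (M + Mᵀ - A)⁻¹ * M)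
    (Pi : Matrix (Fin n) (Fin n) ℝ) (hPi : Pi = P * (Pᵀ * Mtil * P)⁻¹ * Pᵀ * Mtil)
    (KTG : ℝ)
    (hK : IsGreatest {r : ℝ | ∃ v : Fin n → ℝ, v ≠ 0 ∧
        r = (enorm Mtil ((1 - Pi) *ᵥ v)) ^ 2 / (enorm A v) ^ 2} KTG)
    (lmaxD lminD : ℝ)
    (hlmaxD : IsGreatest (spectrum ℝ ((Pᵀ * Mtil * P)⁻¹ * (Bc - Ac))) lmaxD)
    (hlminD : IsLeast (spectrum ℝ ((Pᵀ * Mtil * P)⁻¹ * (Bc - Ac))) lminD)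
    (d₁ d₂ : ℝ) (hd₁ : d₁ = 1 / (1 + lmaxD)) (hd₂ : d₂ = 1 / (1 + lminD))
    (lamax : ℝ) (hlamax : IsGreatest (spectrum ℝ (A⁻¹ * Mtil)) lamax)
    (lbmax : ℝ) (hlbmax : IsGreatest (spectrum ℝ (A⁻¹ * Mtil * Pi)) lbmax)
    (normE : ℝ)
    (hnormE : IsGreatest {r : ℝ | ∃ v : Fin n → ℝ, v ≠ 0 ∧
        r = enorm A (E *ᵥ v) / enorm A v} normE)
    (hcase : d₂ ≤ 1) :
    1 - 1 / max KTG (lamax - d₂ * lbmax + d₂) ≤ normE ∧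
      normE ≤ 1 - 1 / (d₁ * KTG + (1 - d₁) * lamax) := by
  subst hAc hE
  have hA' := (isUnit_iff_isUnit_det _).1 hA.isUnit
  have hN' := (isUnit_iff_isUnit_det _).1 hMMA.isUnit
  have hAt := transpose_eq_of_isHermitian hA.1
  have hMt : IsUnit Mᵀ.det := by rwa [det_transpose]
  have hPinj : Function.Injective P.mulVec := by
    rw [mulVec_injective_iff, linearIndependent_iff_card_eq_finrank_span, Set.finrank,
      ← rank_eq_finrank_span_cols, hP, Fintype.card_fin]
  -- the symmetrized smoother
  have hT : Mtil.PosDef := by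
    have h := hMMA.inv.conjTranspose_mul_mul_same (B := M)
      (mulVec_injective_of_isUnit ((isUnit_iff_isUnit_det _).2 hM))
    rwa [conjTranspose_eq_transpose_of_trivial, ← hMtil] at h
  have hTt := transpose_eq_of_isHermitian hT.1
  have hTinv : Mtil⁻¹ = M⁻¹ * (M + Mᵀ - A) * Mᵀ⁻¹ := by
    rw [hMtil, Matrix.mul_inv_rev, Matrix.mul_inv_rev, nonsing_inv_nonsing_inv _ hN',
      Matrix.mul_assoc]
  set S := 1 - M⁻¹ * A with hSdef
  have hSt : Sᵀ = 1 - A * Mᵀ⁻¹ := by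
    rw [hSdef, transpose_sub, transpose_one, transpose_mul, hAt, transpose_nonsing_inv]
  have hS : S * A⁻¹ * Sᵀ = A⁻¹ - Mtil⁻¹ := by
    rw [hSt, hTinv]
    exact smoother_mul_inv_mul_adjoint rfl (mul_nonsing_inv _ hA') (nonsing_inv_mul _ hA')
      (nonsing_inv_mul _ hM) (mul_nonsing_inv _ hMt)
  have hAT := quad_le_quad_of_smoother hA hT hS
  -- the coarse space
  set Tc := Pᵀ * Mtil * P with hTcdef
  have hTc : Tc.PosDef := by
    have h := hT.conjTranspose_mul_mul_same hPinj
    rwa [conjTranspose_eq_transpose_of_trivial] at h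
  have hPiP : Pi * P = P := by rw [hPi]; exact coarseProjection_mul_self hTc
  have hPiPi : Pi * Pi = Pi := by
    nth_rw 2 [hPi]
    simp only [← Matrix.mul_assoc, hPiP]
    exact hPi.symm
  have hTPi : (Mtil * Pi)ᵀ = Mtil * Pi := by
    rw [hPi]; exact mul_coarseProjection_transpose hTt
  have hQQ : (1 - Pi) * (1 - Pi) = 1 - Pi := by simp [Matrix.mul_sub, Matrix.sub_mul, hPiPi]
  have hTQ : (Mtil * (1 - Pi))ᵀ = Mtil * (1 - Pi) := by
    rw [Matrix.mul_sub, Matrix.mul_one, transpose_sub, hTPi, hTt]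
  have hpyth := quad_add_quad_complement hTt hPiPi hTPi
  -- the coarse-grid perturbation
  have hDt : (Bc - Pᵀ * A * P)ᵀ = Bc - Pᵀ * A * P := by
    simp only [transpose_sub, transpose_mul, transpose_transpose, hAt, Matrix.mul_assoc,
      transpose_eq_of_isHermitian hBc.1]
  have hDmax := quad_le_of_spectrum_le hTc hDt hlmaxD.2
  have hDmin := le_quad_of_le_spectrum hTc hDt hlminD.2
  obtain ⟨w, hw, hDw⟩ := exists_quad_eq_of_mem_spectrum hTc hlminD.1
  set H := Bc + (Tc - Pᵀ * A * P) with hHdef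
  have hcoarse : (Tc - Pᵀ * A * P).PosSemidef := by
    refine posSemidef_of_quad_nonneg ?_ fun c => ?_
    · simp only [hTcdef, transpose_sub, transpose_mul, transpose_transpose, hAt, hTt,
        Matrix.mul_assoc]
    · rw [quad_sub, hTcdef, ← quad_mulVec, ← quad_mulVec]
      linarith [hAT (P *ᵥ c)]
  have hH : H.PosDef := hBc.add_posSemidef hcoarse
  have hHquad (c : Fin nc → ℝ) : quad H c = quad Tc c + quad (Bc - Pᵀ * A * P) c := by
    rw [hHdef, ← quad_add]; congr 1; abel
  have hmin0 : 0 ≤ lminD := by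
    have h1 := quad_pos hH hw
    have h2 := quad_pos hTc hw
    rw [hHquad, hDw] at h1
    have h3 : 0 < 1 + lminD := by
      by_contra! h
      nlinarith
    rw [hd₂, div_le_one h3] at hcase
    linarith
  have hmax0 : 0 ≤ lmaxD := hmin0.trans (hlminD.2 hlmaxD.1)
  have hd1 : d₁ * (1 + lmaxD) = 1 := by rw [hd₁]; field_simp
  have hd2 : d₂ * (1 + lminD) = 1 := by rw [hd₂]; field_simp
  have hd1pos : 0 < d₁ := by rw [hd₁]; positivity
  have hd2pos : 0 < d₂ := by rw [hd₂]; positivity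
  have hd1le : d₁ ≤ 1 := by nlinarith
  -- comparison of the inexact and the exact coarse-grid corrections
  set W := Mtil * (P * H⁻¹ * Pᵀ) * Mtil with hWdef
  have hW (v : Fin n → ℝ) : quad W v = quad H⁻¹ (Pᵀ *ᵥ (Mtil *ᵥ v)) := by
    rw [mulVec_mulVec, quad_mulVec, transpose_mul, transpose_transpose, hTt, hWdef]
    simp only [Matrix.mul_assoc]
  have hPiq (v : Fin n → ℝ) : quad Mtil (Pi *ᵥ v) = quad Tc⁻¹ (Pᵀ *ᵥ (Mtil *ᵥ v)) := by
    rw [quad_projection hTt hPiPi hTPi, mulVec_mulVec, quad_mulVec, transpose_mul,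
      transpose_transpose, hTt, hPi]
    simp only [Matrix.mul_assoc]
  have hWlower (v : Fin n → ℝ) : d₁ * quad Mtil (Pi *ᵥ v) ≤ quad W v := by
    have h := quad_inv_le_quad_inv hTc hH (μ := 1 + lmaxD) (by linarith)
      (fun c => by rw [hHquad]; linarith [hDmax c]) (Pᵀ *ᵥ (Mtil *ᵥ v))
    rw [← hPiq, ← hW] at h
    calc _ ≤ d₁ * ((1 + lmaxD) * quad W v) := by gcongr
      _ = quad W v := by rw [← mul_assoc, hd1, one_mul]
  have hWupper (v : Fin n → ℝ) : quad W v ≤ d₂ * quad Mtil (Pi *ᵥ v) := by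
    rw [hW, hPiq]
    refine quad_inv_le_quad_inv hH hTc hd2pos.le (fun c => ?_) _
    calc quad Tc c = d₂ * ((1 + lminD) * quad Tc c) := by rw [← mul_assoc, hd2, one_mul]
      _ ≤ d₂ * quad H c := by gcongr; rw [hHquad]; linarith [hDmin c]
  -- the inverse of the two-grid preconditioner
  set E := (1 - Mᵀ⁻¹ * A) * (1 - P * Bc⁻¹ * Pᵀ * A) * S with hEdef
  set B := A + Sᵀ * Mtil * S - Sᵀ * W * S with hBdef
  have hC : (A⁻¹ - E * A⁻¹).PosDef := preconditioner_posDef hA hM hMMA hBc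
  have hBC : B * (A⁻¹ - E * A⁻¹) = 1 := by
    have hres := coarse_resolvent (D := Mtil - A) (P := P) hBc hH (by
      rw [Matrix.mul_sub, Matrix.sub_mul, hHdef]; abel)
    have h := woodbury_mul_eq_one (n := M + Mᵀ - A) rfl (mul_nonsing_inv _ hN')
      (nonsing_inv_mul _ hN') (mul_nonsing_inv _ hA') (mul_nonsing_inv _ hM)
      (nonsing_inv_mul _ hMt) (mul_nonsing_inv _ hMt) (by rw [← hMtil]; exact hres)
    rw [← hMtil, ← hSt, ← hSdef] at h
    rw [hBdef, hWdef, hEdef]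
    simpa only [Matrix.mul_assoc] using h
  have hBq (s : Fin n → ℝ) :
      quad B s = quad A s + quad Mtil (S *ᵥ s) - quad W (S *ᵥ s) := by
    rw [hBdef, quad_sub, quad_add, quad_mulVec, quad_mulVec]
  have hEpsd : (A * E).PosSemidef := iteration_posSemidef hA hBc fun c => by
    have h := hDmin c
    rw [quad_sub] at h
    linarith [mul_nonneg hmin0 (quad_nonneg hTc.posSemidef c)]
  -- extremal values as bounds for quadratic forms
  have hla : ∀ v, quad Mtil ((1 : Matrix (Fin n) (Fin n) ℝ) *ᵥ v) ≤ lamax * quad A v := by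
    simpa using quad_le_of_spectrum_le hA hTt hlamax.2
  have hlb (v : Fin n → ℝ) : quad Mtil (Pi *ᵥ v) ≤ lbmax * quad A v := by
    rw [quad_projection hTt hPiPi hTPi]
    exact quad_le_of_spectrum_le hA hTPi (by rw [← Matrix.mul_assoc]; exact hlbmax.2) v
  have hKq (v : Fin n → ℝ) : quad Mtil ((1 - Pi) *ᵥ v) ≤ KTG * quad A v := by
    rcases eq_or_ne v 0 with rfl | hv
    · simp [quad]
    · have h := hK.2 ⟨v, hv, rfl⟩
      rwa [enorm_sq hT.posSemidef, enorm_sq hA.posSemidef, div_le_iff₀ (quad_pos hA hv)] at h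
  obtain ⟨vK, hvK, hKeq⟩ := hK.1
  rw [enorm_sq hT.posSemidef, enorm_sq hA.posSemidef, eq_div_iff (quad_pos hA hvK).ne'] at hKeq
  have hPi0 : Pi ≠ 0 := by
    rintro h
    rw [h, Matrix.zero_mul] at hPiP
    exact hw (hPinj (by simp [← hPiP]))
  have hPi1 : 1 - Pi ≠ 0 := by
    intro h
    have h1 : Pi.rank ≤ nc := by
      rw [hPi, Matrix.mul_assoc, Matrix.mul_assoc]
      exact (rank_mul_le_left _ _).trans_eq hP
    rw [← sub_eq_zero.1 h, rank_one, Fintype.card_fin] at h1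
    omega
  have h10 : (1 : Matrix (Fin n) (Fin n) ℝ) ≠ 0 := by
    intro h
    exact hPi0 (by rw [← Matrix.mul_one Pi, h, Matrix.mul_zero])
  have hTone : (Mtil * 1)ᵀ = Mtil * 1 := by rwa [Matrix.mul_one]
  have hK1 := one_le_of_projection hA hT hS hQQ hPi1 hKq
  have hlb1 := one_le_of_projection hA hT hS hPiPi hPi0 hlb
  obtain ⟨vE, hvE, hEeq⟩ := hnormE.1
  constructor
  · have hmax : 0 < max KTG (lamax - d₂ * lbmax + d₂) := lt_max_of_lt_left (by linarith)
    rcases le_or_gt 1 normE with hge | hlt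
    · have := one_div_pos.2 hmax
      linarith
    have hE0 : 0 ≤ normE := by rw [hEeq]; exact div_nonneg (Real.sqrt_nonneg _) (Real.sqrt_nonneg _)
    obtain ⟨U, hU⟩ : ∃ U, U = 1 / (1 - normE) := ⟨_, rfl⟩
    have hUpos : 0 < U := by rw [hU]; exact one_div_pos.2 (by linarith)
    have hUE : normE = 1 - 1 / U := by rw [hU, one_div_one_div]; ring
    have hU1 : 1 ≤ U := by rw [hU, le_div_iff₀ (by linarith)]; linarith
    have hBU := (quad_mul_le_iff hA hC hBC hUpos).1 (by
      rw [← hUE]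
      exact quad_mul_le_of_enorm_le hA fun v hv => hnormE.2 ⟨v, hv, rfl⟩)
    have hsmooth (x : Fin n → ℝ) :
        quad Mtil (S *ᵥ x) - d₂ * quad Mtil (Pi *ᵥ (S *ᵥ x)) ≤ (U - 1) * quad A x := by
      have h1 := hBU x
      rw [hBq] at h1
      linarith [hWupper (S *ᵥ x)]
    have hKU : KTG ≤ U := by
      have h := quad_le_of_quad_smoothed_le hA hT hS hQQ hTQ hU1 (fun x => by
        have h1 := hsmooth x
        have h2 := hpyth (S *ᵥ x)
        have h3 := quad_nonneg hT.posSemidef (Pi *ᵥ (S *ᵥ x))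
        nlinarith) vK
      rw [← hKeq] at h
      exact le_of_mul_le_mul_right h (quad_pos hA hvK)
    have hlaU : lamax ≤ U + d₂ * (lbmax - 1) := by
      obtain ⟨z, hz, hzeq⟩ := exists_quad_eq_of_mem_spectrum hA hlamax.1
      have h := quad_le_of_quad_smoothed_le hA hT hS (Matrix.one_mul 1) hTone
        (κ := U + d₂ * (lbmax - 1)) (by nlinarith) (fun x => by
          have h1 := hsmooth x
          have h2 := quad_smoothed_le hA hT hS hPiPi hTPi hPi0 hlb x
          have h3 := mul_le_mul_of_nonneg_left h2 hd2pos.le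
          rw [one_mulVec]
          linarith) z
      rw [one_mulVec, hzeq] at h
      exact le_of_mul_le_mul_right h (quad_pos hA hz)
    have hmaxU : max KTG (lamax - d₂ * lbmax + d₂) ≤ U := max_le hKU (by linarith)
    rw [hUE]
    linarith [one_div_le_one_div_of_le hmax hmaxU]
  · have hla1 := one_le_of_projection hA hT hS (Matrix.one_mul 1) h10 hla
    have hUpos : 0 < d₁ * KTG + (1 - d₁) * lamax := by
      have := mul_pos hd1pos (zero_lt_one.trans_le hK1)
      have := mul_nonneg (sub_nonneg.2 hd1le) (zero_le_one.trans hla1)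
      linarith
    have h := (quad_mul_le_iff hA hC hBC hUpos).2 fun s => by
      have h1 := quad_smoothed_le hA hT hS hQQ hTQ hPi1 hKq s
      have h2 := quad_smoothed_le hA hT hS (Matrix.one_mul 1) hTone h10 hla s
      rw [one_mulVec] at h2
      have h3 := hWlower (S *ᵥ s)
      have h4 := mul_le_mul_of_nonneg_left h1 hd1pos.le
      have h5 := mul_le_mul_of_nonneg_left h2 (sub_nonneg.2 hd1le)
      rw [hBq, ← hpyth (S *ᵥ s)]
      rw [← hpyth (S *ᵥ s)] at h5
      linarith
    rw [hEeq]
    exact enorm_div_le_of_quad_mul_le hA hEpsd h hvE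
end

section
/- Let A ∈ ℝ^{n×n} be SPD, M ∈ ℝ^{n×n} nonsingular with M + Mᵀ − A SPD, P ∈ ℝ^{n×n_c} of full column rank, A_c := PᵀAP, B_c ∈ ℝ^{n_c×n_c} SPD, and let E_ITG = (I−M^{-T}A)(I−P B_c^{-1}PᵀA)(I−M^{-1}A). Set M̃ := Mᵀ(M+Mᵀ−A)^{-1}M, Π_M̃ := P(PᵀM̃P)^{-1}PᵀM̃, K_TG := max_{v≠0} ‖(I−Π_M̃)v‖²_M̃/‖v‖²_A, d₁ := 1/(1+λ_max((PᵀM̃P)^{-1}(B_c−A_c))), d₂ := 1/(1+λ_min((PᵀM̃P)^{-1}(B_c−A_c))). If d₁ ≤ 1 < d₂ < λ_max(A^{-1}M̃Π_M̃)/(λ_max(A^{-1}M̃Π_M̃)−1), then L₂ ≤ ‖E_ITG‖_A ≤ max{U₁, U₂}, where L₂ = 1 − 1/max{λ_min(A^{-1}M̃), d₂K_TG + (1−d₂)λ_max(A^{-1}M̃)}, U₁ = 1 − 1/(d₁K_TG + (1−d₁)λ_max(A^{-1}M̃)), and U₂ = 1/((1−d₂)λ_max(A^{-1}M̃Π_M̃)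 + d₂) − 1. -/
open Matrix

section QuadraticForms

variable {m : Type*} [Fintype m]

lemma dotProduct_mulVec_comm_of_isHermitian {G : Matrix m m ℝ} (hG : G.IsHermitian)
    (x y : m → ℝ) : x ⬝ᵥ G *ᵥ y = y ⬝ᵥ G *ᵥ x := by
  have hG' : Gᵀ = G := by simpa using hG.eq
  rw [dotProduct_mulVec, ← mulVec_transpose, hG', dotProduct_comm]

lemma dotProduct_transpose_mul_mul_mulVec {k : Type*} [Fintype k] (R : Matrix k m ℝ)
    (H : Matrix k k ℝ) (x y : m → ℝ) :
    x ⬝ᵥ (Rᵀ * H * R) *ᵥ y = (R *ᵥ x) ⬝ᵥ H *ᵥ (R *ᵥ y) := by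
  rw [← mulVec_mulVec, ← mulVec_mulVec, dotProduct_mulVec, vecMul_transpose]

lemma Matrix.PosSemidef.dotProduct_nonneg {G : Matrix m m ℝ} (hG : G.PosSemidef) (x : m → ℝ) :
    0 ≤ x ⬝ᵥ G *ᵥ x := by
  simpa using hG.dotProduct_mulVec_nonneg x

lemma Matrix.PosDef.dotProduct_pos {G : Matrix m m ℝ} (hG : G.PosDef) {x : m → ℝ} (hx : x ≠ 0) :
    0 < x ⬝ᵥ G *ᵥ x := by
  simpa using hG.dotProduct_mulVec_pos hx

lemma Matrix.PosSemidef.cauchy_schwarz {G : Matrix m m ℝ} (hG : G.PosSemidef) (x y : m → ℝ) :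
    (x ⬝ᵥ G *ᵥ y) ^ 2 ≤ (x ⬝ᵥ G *ᵥ x) * (y ⬝ᵥ G *ᵥ y) := by
  have h : ∀ t : ℝ, 0 ≤ (y ⬝ᵥ G *ᵥ y) * (t * t) + (2 * (x ⬝ᵥ G *ᵥ y)) * t + x ⬝ᵥ G *ᵥ x := by
    intro t
    have := hG.dotProduct_nonneg (x + t • y)
    simp only [mulVec_add, mulVec_smul, dotProduct_add, add_dotProduct, dotProduct_smul,
      smul_dotProduct, smul_eq_mul, dotProduct_mulVec_comm_of_isHermitian hG.isHermitian y x]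
      at this
    linarith
  have := discrim_le_zero h
  rw [discrim] at this
  linarith

variable [DecidableEq m]

lemma Matrix.PosDef.mul_inv_cancel {A : Matrix m m ℝ} (hA : A.PosDef) : A * A⁻¹ = 1 :=
  mul_nonsing_inv _ ((isUnit_iff_isUnit_det _).1 hA.isUnit)

lemma Matrix.PosDef.inv_mul_cancel {A : Matrix m m ℝ} (hA : A.PosDef) : A⁻¹ * A = 1 :=
  nonsing_inv_mul _ ((isUnit_iff_isUnit_det _).1 hA.isUnit)

lemma Matrix.PosDef.mulVec_inv_mulVec {A : Matrix m m ℝ} (hA : A.PosDef) (x : m → ℝ) :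
    A *ᵥ (A⁻¹ *ᵥ x) = x := by
  rw [mulVec_mulVec, hA.mul_inv_cancel, one_mulVec]

/-- If `0 ≤ Y ≤ μ A`, then `Y A⁻¹ Y ≤ μ Y`. -/
lemma dotProduct_inv_mulVec_le {A Y : Matrix m m ℝ} (hA : A.PosDef) (hY : Y.PosSemidef) {μ : ℝ}
    (hμ : 0 ≤ μ) (hle : ∀ x, x ⬝ᵥ Y *ᵥ x ≤ μ * (x ⬝ᵥ A *ᵥ x)) (x : m → ℝ) :
    (Y *ᵥ x) ⬝ᵥ A⁻¹ *ᵥ (Y *ᵥ x) ≤ μ * (x ⬝ᵥ Y *ᵥ x) := by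
  set s := A⁻¹ *ᵥ (Y *ᵥ x) with hs
  have hAs : A *ᵥ s = Y *ᵥ x := hA.mulVec_inv_mulVec _
  have ht : 0 ≤ (Y *ᵥ x) ⬝ᵥ s := hA.inv.posSemidef.dotProduct_nonneg _
  have h1 := hY.cauchy_schwarz s x
  have h2 := hle s
  rw [hAs] at h2
  rw [dotProduct_comm] at ht ⊢
  have h3 := hY.dotProduct_nonneg x
  rcases ht.eq_or_lt with h0 | h0
  · rw [← h0]; positivity
  · nlinarith [mul_le_mul_of_nonneg_right h2 h3]

/-- `⟨x, y⟩² ≤ ⟨A x, x⟩ ⟨A⁻¹ y, y⟩`. -/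
lemma sq_dotProduct_mulVec_le_s8 {A : Matrix m m ℝ} (hA : A.PosDef) (x y : m → ℝ) :
    (x ⬝ᵥ y) ^ 2 ≤ (x ⬝ᵥ A *ᵥ x) * (y ⬝ᵥ A⁻¹ *ᵥ y) := by
  have h := hA.posSemidef.cauchy_schwarz x (A⁻¹ *ᵥ y)
  rw [hA.mulVec_inv_mulVec] at h
  rwa [dotProduct_comm y]

/-- Inversion reverses the Loewner order. -/
lemma dotProduct_inv_mulVec_le_of_le {U V : Matrix m m ℝ} (hU : U.PosDef) (hV : V.PosDef) {c : ℝ}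
    (hc : 0 ≤ c) (hle : ∀ x, x ⬝ᵥ U *ᵥ x ≤ c * (x ⬝ᵥ V *ᵥ x)) (y : m → ℝ) :
    y ⬝ᵥ V⁻¹ *ᵥ y ≤ c * (y ⬝ᵥ U⁻¹ *ᵥ y) := by
  have h := dotProduct_inv_mulVec_le hV hU.posSemidef hc hle (U⁻¹ *ᵥ y)
  rwa [hU.mulVec_inv_mulVec, dotProduct_comm _ y] at h

/-- If `H (R A⁻¹ Rᵀ) H ≤ c H`, then `Rᵀ H R ≤ c A`. -/
lemma dotProduct_conj_le {A H R : Matrix m m ℝ} (hA : A.PosDef) (hH : H.PosSemidef) {c : ℝ}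
    (hc : 0 ≤ c)
    (hle : ∀ x, (H *ᵥ x) ⬝ᵥ (R * A⁻¹ * Rᵀ) *ᵥ (H *ᵥ x) ≤ c * (x ⬝ᵥ H *ᵥ x)) (v : m → ℝ) :
    (R *ᵥ v) ⬝ᵥ H *ᵥ (R *ᵥ v) ≤ c * (v ⬝ᵥ A *ᵥ v) := by
  have h1 := sq_dotProduct_mulVec_le_s8 hA v (Rᵀ *ᵥ (H *ᵥ (R *ᵥ v)))
  have h2 := hle (R *ᵥ v)
  have h3 := dotProduct_transpose_mul_mul_mulVec Rᵀ A⁻¹ (H *ᵥ (R *ᵥ v)) (H *ᵥ (R *ᵥ v))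
  rw [transpose_transpose] at h3
  have h4 : v ⬝ᵥ (Rᵀ *ᵥ (H *ᵥ (R *ᵥ v))) = (R *ᵥ v) ⬝ᵥ H *ᵥ (R *ᵥ v) := by
    rw [dotProduct_mulVec, vecMul_transpose]
  rw [h3] at h2
  rw [h4] at h1
  have h5 := hH.dotProduct_nonneg (R *ᵥ v)
  have h6 := hA.posSemidef.dotProduct_nonneg v
  rcases h5.eq_or_lt with h0 | h0
  · rw [← h0]; positivity
  · nlinarith [mul_le_mul_of_nonneg_left h2 h6]

lemma dotProduct_conj_le_sub_one {A W H R : Matrix m m ℝ} (hA : A.PosDef) (hH : H.PosSemidef)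
    (hR : R * A⁻¹ * Rᵀ = A⁻¹ - W⁻¹) (hHW : H * W⁻¹ * H = H) {c : ℝ} (hc : 1 ≤ c)
    (hle : ∀ x, x ⬝ᵥ H *ᵥ x ≤ c * (x ⬝ᵥ A *ᵥ x)) (v : m → ℝ) :
    (R *ᵥ v) ⬝ᵥ H *ᵥ (R *ᵥ v) ≤ (c - 1) * (v ⬝ᵥ A *ᵥ v) := by
  refine dotProduct_conj_le hA hH (by linarith) (fun x => ?_) v
  have hHt : Hᵀ = H := by simpa using hH.isHermitian.eq
  have h1 := dotProduct_inv_mulVec_le hA hH (by linarith) hle x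
  have h2 := dotProduct_transpose_mul_mul_mulVec H W⁻¹ x x
  rw [hHt, hHW] at h2
  rw [hR, sub_mulVec, dotProduct_sub, ← h2]
  linarith

lemma posSemidef_of_spectrum_inv_mul_nonneg {A H : Matrix m m ℝ} (hA : A.PosDef)
    (hH : H.IsHermitian) (h : ∀ t ∈ spectrum ℝ (A⁻¹ * H), 0 ≤ t) : H.PosSemidef := by
  obtain ⟨B, hB⟩ : ∃ B : Matrix m m ℝ, A = Bᴴ * B := by
    open scoped MatrixOrder in
    exact CStarAlgebra.nonneg_iff_eq_star_mul_self.1 hA.posSemidef.nonneg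
  have hBu : IsUnit B := by
    have := hA.isUnit
    rw [hB, isUnit_iff_isUnit_det, det_mul] at this
    exact (isUnit_iff_isUnit_det _).2 (isUnit_of_mul_isUnit_right this)
  have hBd := (isUnit_iff_isUnit_det _).1 hBu
  have hC : ((B⁻¹)ᴴ * H * B⁻¹).PosSemidef := by
    rw [posSemidef_iff_isHermitian_and_spectrum_nonneg]
    refine ⟨isHermitian_conjTranspose_mul_mul _ hH, fun t ht => ?_⟩
    refine h t ?_
    have : (B⁻¹)ᴴ * H * B⁻¹ = B * (A⁻¹ * H) * B⁻¹ := by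
      rw [hB, Matrix.mul_inv_rev, conjTranspose_nonsing_inv]
      simp only [← Matrix.mul_assoc, mul_nonsing_inv _ hBd, Matrix.one_mul]
    rw [this] at ht
    have h2 := spectrum.units_conjugate (R := ℝ) (a := A⁻¹ * H) (u := hBu.unit)
    rw [← h2]
    simpa [coe_units_inv] using ht
  have := hC.conjTranspose_mul_mul_same B
  have e : Bᴴ * ((B⁻¹)ᴴ * H * B⁻¹) * B = H := by
    rw [← Matrix.mul_assoc, ← Matrix.mul_assoc, ← conjTranspose_mul, nonsing_inv_mul _ hBd,
      Matrix.mul_assoc, nonsing_inv_mul _ hBd]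
    simp
  rwa [e] at this

lemma dotProduct_mulVec_le_of_spectrum_le {A H : Matrix m m ℝ} (hA : A.PosDef)
    (hH : H.IsHermitian) {l : ℝ} (h : ∀ t ∈ spectrum ℝ (A⁻¹ * H), t ≤ l) (x : m → ℝ) :
    x ⬝ᵥ H *ᵥ x ≤ l * (x ⬝ᵥ A *ᵥ x) := by
  have hp : (l • A - H).PosSemidef := by
    refine posSemidef_of_spectrum_inv_mul_nonneg hA
      ((hA.isHermitian.smul (IsSelfAdjoint.all l)).sub hH) fun t ht => ?_
    have e : A⁻¹ * (l • A - H) = algebraMap ℝ _ l - A⁻¹ * H := by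
      rw [Matrix.mul_sub, Matrix.mul_smul, hA.inv_mul_cancel, Algebra.algebraMap_eq_smul_one]
    rw [e, ← spectrum.singleton_sub_eq] at ht
    obtain ⟨_, rfl, s, hs, rfl⟩ := ht
    simpa using h s hs
  have := hp.dotProduct_nonneg x
  rw [sub_mulVec, dotProduct_sub, smul_mulVec, dotProduct_smul, smul_eq_mul] at this
  linarith

lemma le_dotProduct_mulVec_of_le_spectrum {A H : Matrix m m ℝ} (hA : A.PosDef)
    (hH : H.IsHermitian) {l : ℝ} (h : ∀ t ∈ spectrum ℝ (A⁻¹ * H), l ≤ t) (x : m → ℝ) :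
    l * (x ⬝ᵥ A *ᵥ x) ≤ x ⬝ᵥ H *ᵥ x := by
  have := dotProduct_mulVec_le_of_spectrum_le hA hH.neg (l := -l) (fun t ht => by
    rw [Matrix.mul_neg, ← spectrum.neg_eq] at ht
    have := h _ ht
    linarith) x
  rw [neg_mulVec, dotProduct_neg] at this
  linarith

lemma exists_mulVec_eq_smul_of_mem_spectrum {A H : Matrix m m ℝ} (hA : A.PosDef) {l : ℝ}
    (hl : l ∈ spectrum ℝ (A⁻¹ * H)) : ∃ x, x ≠ 0 ∧ H *ᵥ x = l • A *ᵥ x := by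
  rw [spectrum.mem_iff, isUnit_iff_isUnit_det, isUnit_iff_ne_zero, not_not,
    ← exists_mulVec_eq_zero_iff] at hl
  obtain ⟨x, hx, h⟩ := hl
  refine ⟨x, hx, ?_⟩
  rw [Algebra.algebraMap_eq_smul_one, sub_mulVec, smul_mulVec, one_mulVec, sub_eq_zero,
    ← mulVec_mulVec] at h
  have h' := congrArg (A *ᵥ ·) h
  simp only [mulVec_smul, hA.mulVec_inv_mulVec] at h'
  exact h'.symm

end QuadraticForms

section EnergyNorm

variable {m : Type*} [Fintype m]

lemma energyNorm_sq {G : Matrix m m ℝ} (hG : G.PosSemidef) (v : m → ℝ) :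
    (_root_.enorm G v) ^ 2 = v ⬝ᵥ G *ᵥ v :=
  Real.sq_sqrt (hG.dotProduct_nonneg v)

lemma energyNorm_pos {G : Matrix m m ℝ} (hG : G.PosDef) {v : m → ℝ} (hv : v ≠ 0) :
    0 < _root_.enorm G v :=
  Real.sqrt_pos.2 (hG.dotProduct_pos hv)

lemma energyNorm_mulVec_le {A E : Matrix m m ℝ} (hA : A.PosDef) (hAE : (A * E).IsHermitian) {c : ℝ}
    (hc : 0 < c) (hle : ∀ v, v ⬝ᵥ (A * E) *ᵥ v ≤ c * (v ⬝ᵥ A *ᵥ v))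
    (hge : ∀ v, -c * (v ⬝ᵥ A *ᵥ v) ≤ v ⬝ᵥ (A * E) *ᵥ v) (v : m → ℝ) :
    _root_.enorm A (E *ᵥ v) ≤ c * _root_.enorm A v := by
  refine le_of_sq_le_sq ?_ (mul_nonneg hc.le (Real.sqrt_nonneg _))
  rw [mul_pow, energyNorm_sq hA.posSemidef, energyNorm_sq hA.posSemidef]
  set w := E *ᵥ v with hw
  have h1 := hle (c • v + w)
  have h2 := hge (c • v - w)
  have h3 : w ⬝ᵥ (A * E) *ᵥ v = w ⬝ᵥ A *ᵥ w := by rw [← mulVec_mulVec]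
  simp only [mulVec_add, mulVec_sub, mulVec_smul, dotProduct_add, dotProduct_sub,
    add_dotProduct, sub_dotProduct, dotProduct_smul, smul_dotProduct, smul_eq_mul,
    dotProduct_mulVec_comm_of_isHermitian hA.isHermitian v w,
    dotProduct_mulVec_comm_of_isHermitian hAE v w, h3] at h1 h2
  nlinarith

lemma le_energyNorm_mulVec_div {A E : Matrix m m ℝ} (hA : A.PosDef) {c : ℝ} {v : m → ℝ} (hv : v ≠ 0)
    (h : c * (v ⬝ᵥ A *ᵥ v) ≤ v ⬝ᵥ (A * E) *ᵥ v) :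
    c ≤ _root_.enorm A (E *ᵥ v) / _root_.enorm A v := by
  have hpos := energyNorm_pos hA hv
  rw [le_div_iff₀ hpos]
  refine le_of_mul_le_mul_right ?_ hpos
  calc c * _root_.enorm A v * _root_.enorm A v = c * (v ⬝ᵥ A *ᵥ v) := by
        rw [mul_assoc, ← sq, energyNorm_sq hA.posSemidef]
    _ ≤ v ⬝ᵥ (A * E) *ᵥ v := h
    _ ≤ _root_.enorm A (E *ᵥ v) * _root_.enorm A v := by
        refine le_of_sq_le_sq ?_ (mul_nonneg (Real.sqrt_nonneg _) hpos.le)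
        rw [mul_pow, energyNorm_sq hA.posSemidef, energyNorm_sq hA.posSemidef, ← mulVec_mulVec,
          mul_comm]
        exact hA.posSemidef.cauchy_schwarz v (E *ᵥ v)

end EnergyNorm

section ErrorForm

variable {m : Type*} [Fintype m] [DecidableEq m]

lemma dotProduct_error_eq {A E Y : Matrix m m ℝ} (hA : A.PosDef)
    (hinv : (1 - E) * (A⁻¹ * Y) = 1) (v : m → ℝ) :
    (A⁻¹ *ᵥ (Y *ᵥ v)) ⬝ᵥ (A * E) *ᵥ (A⁻¹ *ᵥ (Y *ᵥ v)) =
      (Y *ᵥ v) ⬝ᵥ A⁻¹ *ᵥ (Y *ᵥ v) - v ⬝ᵥ Y *ᵥ v := by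
  set w := A⁻¹ *ᵥ (Y *ᵥ v) with hw
  have hAw : A *ᵥ w = Y *ᵥ v := hA.mulVec_inv_mulVec _
  have hv : w - E *ᵥ w = v := by
    have := congrArg (· *ᵥ v) hinv
    simpa [← mulVec_mulVec, sub_mulVec, ← hw] using this
  have hE : E *ᵥ w = w - v := by rw [← hv, sub_sub_cancel]
  rw [← mulVec_mulVec, hE, mulVec_sub, dotProduct_sub, hAw,
    dotProduct_mulVec_comm_of_isHermitian hA.isHermitian w v, hAw, dotProduct_comm w]

lemma dotProduct_inv_mulVec_eq {A Y : Matrix m m ℝ} (hA : A.PosDef) (v : m → ℝ) :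
    (A⁻¹ *ᵥ (Y *ᵥ v)) ⬝ᵥ A *ᵥ (A⁻¹ *ᵥ (Y *ᵥ v)) = (Y *ᵥ v) ⬝ᵥ A⁻¹ *ᵥ (Y *ᵥ v) := by
  rw [hA.mulVec_inv_mulVec, dotProduct_comm]

lemma exists_eq_inv_mulVec {A E Y : Matrix m m ℝ} (hinv : (1 - E) * (A⁻¹ * Y) = 1) (w : m → ℝ) :
    ∃ v, w = A⁻¹ *ᵥ (Y *ᵥ v) := by
  refine ⟨(1 - E) *ᵥ w, ?_⟩
  rw [mulVec_mulVec, mulVec_mulVec, mul_eq_one_comm.1 hinv, one_mulVec]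

lemma dotProduct_error_le {A E Y : Matrix m m ℝ} (hA : A.PosDef) (hY : Y.PosSemidef)
    (hinv : (1 - E) * (A⁻¹ * Y) = 1) {μ : ℝ} (hμ : 0 < μ)
    (hle : ∀ v, v ⬝ᵥ Y *ᵥ v ≤ μ * (v ⬝ᵥ A *ᵥ v)) (w : m → ℝ) :
    w ⬝ᵥ (A * E) *ᵥ w ≤ (1 - 1 / μ) * (w ⬝ᵥ A *ᵥ w) := by
  obtain ⟨v, rfl⟩ := exists_eq_inv_mulVec hinv w
  rw [dotProduct_error_eq hA hinv, dotProduct_inv_mulVec_eq hA]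
  have h := dotProduct_inv_mulVec_le hA hY hμ.le hle v
  rw [← div_le_iff₀' hμ] at h
  rw [sub_mul, one_div_mul_eq_div]
  linarith

lemma dotProduct_form_le {A Y : Matrix m m ℝ} (hA : A.PosDef) {μ : ℝ} (hμ : 0 < μ) {v : m → ℝ}
    (hle : μ * (v ⬝ᵥ A *ᵥ v) ≤ v ⬝ᵥ Y *ᵥ v) :
    v ⬝ᵥ Y *ᵥ v ≤ 1 / μ * ((Y *ᵥ v) ⬝ᵥ A⁻¹ *ᵥ (Y *ᵥ v)) := by
  have h := sq_dotProduct_mulVec_le_s8 hA v (Y *ᵥ v)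
  have h1 := hA.posSemidef.dotProduct_nonneg v
  have h2 := hA.inv.posSemidef.dotProduct_nonneg (Y *ᵥ v)
  rw [one_div_mul_eq_div, le_div_iff₀ hμ]
  rcases (show 0 ≤ v ⬝ᵥ Y *ᵥ v by nlinarith).eq_or_lt with h0 | h0
  · rw [← h0]; simpa using h2
  · refine le_of_mul_le_mul_right ?_ h0
    nlinarith [mul_le_mul_of_nonneg_right hle h2]

lemma le_dotProduct_error {A E Y : Matrix m m ℝ} (hA : A.PosDef)
    (hinv : (1 - E) * (A⁻¹ * Y) = 1) {μ : ℝ} (hμ : 0 < μ)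
    (hle : ∀ v, μ * (v ⬝ᵥ A *ᵥ v) ≤ v ⬝ᵥ Y *ᵥ v) (w : m → ℝ) :
    (1 - 1 / μ) * (w ⬝ᵥ A *ᵥ w) ≤ w ⬝ᵥ (A * E) *ᵥ w := by
  obtain ⟨v, rfl⟩ := exists_eq_inv_mulVec hinv w
  rw [dotProduct_error_eq hA hinv, dotProduct_inv_mulVec_eq hA]
  linarith [dotProduct_form_le hA hμ (hle v)]

lemma exists_le_dotProduct_error {A E Y : Matrix m m ℝ} (hA : A.PosDef)
    (hinv : (1 - E) * (A⁻¹ * Y) = 1) {μ : ℝ} (hμ : 0 < μ)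
    (hle : ∃ v, v ≠ 0 ∧ μ * (v ⬝ᵥ A *ᵥ v) ≤ v ⬝ᵥ Y *ᵥ v) :
    ∃ w, w ≠ 0 ∧ (1 - 1 / μ) * (w ⬝ᵥ A *ᵥ w) ≤ w ⬝ᵥ (A * E) *ᵥ w := by
  obtain ⟨v, hv, hle⟩ := hle
  refine ⟨A⁻¹ *ᵥ (Y *ᵥ v), fun h0 => hv ?_, ?_⟩
  · have := congrArg (· *ᵥ v) hinv
    simpa [← mulVec_mulVec, h0] using this.symm
  · rw [dotProduct_error_eq hA hinv, dotProduct_inv_mulVec_eq hA]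
    linarith [dotProduct_form_le hA hμ hle]

end ErrorForm

section Smoother

lemma exists_mulVec_eq_zero_of_card_lt {m k : Type*} [Fintype m] [Fintype k]
    (Q : Matrix k m ℝ)
    (h : Fintype.card k < Fintype.card m) : ∃ x, x ≠ 0 ∧ Q *ᵥ x = 0 := by
  have := LinearMap.ker_ne_bot_of_finrank_lt (f := Q.mulVecLin) (by simpa using h)
  obtain ⟨x, hx, hx0⟩ := (Submodule.ne_bot_iff _).1 this
  exact ⟨x, hx0, by simpa using hx⟩

variable {m : Type*} [Fintype m] [DecidableEq m]

/-- `(I - M⁻¹A) A⁻¹ (I - M⁻¹A)ᵀ = A⁻¹ - W⁻¹` for the symmetrized smoother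
`W = Mᵀ (M + Mᵀ - A)⁻¹ M`. -/
lemma smoother_mul_inv_mul_transpose {A M : Matrix m m ℝ} (hA : A.PosDef) (hM : IsUnit M.det)
    (hMMA : (M + Mᵀ - A).PosDef) :
    (1 - M⁻¹ * A) * A⁻¹ * (1 - M⁻¹ * A)ᵀ = A⁻¹ - (Mᵀ * (M + Mᵀ - A)⁻¹ * M)⁻¹ := by
  have hAt : Aᵀ = A := by simpa using hA.isHermitian.eq
  have hMt : IsUnit Mᵀ.det := by rwa [det_transpose]
  have e1 : (Mᵀ * (M + Mᵀ - A)⁻¹ * M)⁻¹ = M⁻¹ * (M + Mᵀ - A) * Mᵀ⁻¹ := by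
    rw [Matrix.mul_inv_rev, Matrix.mul_inv_rev,
      nonsing_inv_nonsing_inv _ ((isUnit_iff_isUnit_det _).1 hMMA.isUnit), Matrix.mul_assoc]
  have e2 : (1 - M⁻¹ * A) * A⁻¹ = A⁻¹ - M⁻¹ := by
    rw [Matrix.sub_mul, Matrix.mul_assoc, hA.mul_inv_cancel, Matrix.one_mul, Matrix.mul_one]
  have e3 : (1 - M⁻¹ * A)ᵀ = 1 - A * Mᵀ⁻¹ := by
    rw [transpose_sub, transpose_mul, transpose_one, hAt, transpose_nonsing_inv]
  have e4 : M⁻¹ * (M + Mᵀ - A) * Mᵀ⁻¹ = Mᵀ⁻¹ + M⁻¹ - M⁻¹ * A * Mᵀ⁻¹ := by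
    rw [Matrix.mul_sub, Matrix.mul_add, nonsing_inv_mul _ hM, Matrix.sub_mul, Matrix.add_mul,
      Matrix.one_mul, Matrix.mul_assoc, mul_nonsing_inv _ hMt, Matrix.mul_one]
  rw [e1, e2, e3, e4, Matrix.mul_sub, Matrix.sub_mul, Matrix.sub_mul, ← Matrix.mul_assoc,
    hA.inv_mul_cancel, Matrix.mul_one, Matrix.mul_one, Matrix.one_mul, ← Matrix.mul_assoc]
  abel

variable {k : Type*} [Fintype k] [DecidableEq k]

/-- The inexact coarse correction in terms of a Woodbury-type inverse. -/
lemma coarse_correction_identity {A W : Matrix m m ℝ} {P : Matrix m k ℝ} {B S : Matrix k k ℝ}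
    (hA : A.PosDef) (hW : W.PosDef) (hB : B.PosDef) (hS : S.PosDef)
    (hSeq : S = Pᵀ * W * P + (B - Pᵀ * A * P)) :
    (A - A * P * B⁻¹ * Pᵀ * A) * (A⁻¹ - W⁻¹) * (W - W * P * S⁻¹ * Pᵀ * W) =
      (W - W * P * S⁻¹ * Pᵀ * W) - (A - A * P * B⁻¹ * Pᵀ * A) := by
  set G := A - A * P * B⁻¹ * Pᵀ * A with hG
  set H := W - W * P * S⁻¹ * Pᵀ * W with hH
  set D := B - Pᵀ * A * P with hD
  have e1 : G * A⁻¹ = 1 - A * P * B⁻¹ * Pᵀ := by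
    rw [hG, Matrix.sub_mul, Matrix.mul_assoc _ A, hA.mul_inv_cancel, Matrix.mul_one]
  have e2 : W⁻¹ * H = 1 - P * S⁻¹ * Pᵀ * W := by
    rw [hH, Matrix.mul_sub, hW.inv_mul_cancel]
    simp only [← Matrix.mul_assoc, hW.inv_mul_cancel, Matrix.one_mul]
  have e3 : Pᵀ * H = D * S⁻¹ * Pᵀ * W := by
    have : D = S - Pᵀ * W * P := by rw [hSeq]; abel
    rw [this, hH, Matrix.sub_mul, hS.mul_inv_cancel, Matrix.sub_mul, Matrix.sub_mul,
      Matrix.one_mul, Matrix.mul_sub]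
    simp only [← Matrix.mul_assoc]
  have e4 : G * P = A * P * B⁻¹ * D := by
    rw [hG, hD, Matrix.mul_sub, Matrix.mul_assoc _ B⁻¹ B, hB.inv_mul_cancel, Matrix.mul_one,
      Matrix.sub_mul]
    simp only [← Matrix.mul_assoc]
  clear_value G H
  have e5 : G * (A⁻¹ - W⁻¹) * H = G * A⁻¹ * H - G * (W⁻¹ * H) := by
    rw [Matrix.mul_sub, Matrix.sub_mul, Matrix.mul_assoc _ W⁻¹]
  have e6 : A * P * B⁻¹ * Pᵀ * H = G * (P * S⁻¹ * Pᵀ * W) := by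
    rw [Matrix.mul_assoc _ Pᵀ, e3]
    simp only [← Matrix.mul_assoc]
    rw [e4]
  rw [e5, e1, e2, Matrix.sub_mul, Matrix.one_mul, Matrix.mul_sub, Matrix.mul_one, e6]
  abel

/-- If `R A⁻¹ Rᵀ = N` and `G N H = H - G`, then `I - A⁻¹RᵀGR` inverts `I + A⁻¹RᵀHR`. -/
lemma one_sub_mul_inv_mul_eq_one {A R G H N : Matrix m m ℝ} (hA : A.PosDef)
    (hR : R * A⁻¹ * Rᵀ = N) (hGH : G * N * H = H - G) :
    (1 - A⁻¹ * Rᵀ * G * R) * (A⁻¹ * (A + Rᵀ * H * R)) = 1 := by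
  have e : A⁻¹ * Rᵀ * G * R * (A⁻¹ * (Rᵀ * H * R)) = A⁻¹ * Rᵀ * (G * N * H) * R := by
    rw [← hR]; simp only [Matrix.mul_assoc]
  rw [Matrix.mul_add, hA.inv_mul_cancel, Matrix.mul_add, Matrix.mul_one, Matrix.sub_mul 1, e, hGH]
  simp only [Matrix.mul_sub, Matrix.sub_mul, Matrix.mul_assoc, Matrix.one_mul]
  abel

lemma exists_le_dotProduct_conj {A W H R : Matrix m m ℝ} (hA : A.PosDef) (hH : H.PosSemidef)
    (hR : R * A⁻¹ * Rᵀ = A⁻¹ - W⁻¹) (hHW : H * W⁻¹ * H = H) {c : ℝ} (hc : 1 ≤ c)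
    {x : m → ℝ} (hx : x ≠ 0) (hle : c * (x ⬝ᵥ A *ᵥ x) ≤ x ⬝ᵥ H *ᵥ x) :
    ∃ v, v ≠ 0 ∧ (c - 1) * (v ⬝ᵥ A *ᵥ v) ≤ (R *ᵥ v) ⬝ᵥ H *ᵥ (R *ᵥ v) := by
  rcases hc.eq_or_lt with rfl | hc1
  · exact ⟨x, hx, by simpa only [sub_self, zero_mul] using hH.dotProduct_nonneg _⟩
  have hHt : Hᵀ = H := by simpa using hH.isHermitian.eq
  have hxA := hA.dotProduct_pos hx
  have hxH : 0 < x ⬝ᵥ H *ᵥ x := lt_of_lt_of_le (by positivity) hle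
  set N := R * A⁻¹ * Rᵀ with hN
  set y := H *ᵥ x with hy
  set v := A⁻¹ *ᵥ (Rᵀ *ᵥ y) with hv
  have hRv : R *ᵥ v = N *ᵥ y := by rw [hv, hN, ← mulVec_mulVec, ← mulVec_mulVec]
  have hvA : v ⬝ᵥ A *ᵥ v = y ⬝ᵥ N *ᵥ y := by
    rw [hv, hA.mulVec_inv_mulVec, ← hv, dotProduct_mulVec, vecMul_transpose, hRv,
      dotProduct_comm]
  have h1 : y ⬝ᵥ A⁻¹ *ᵥ y - x ⬝ᵥ y = y ⬝ᵥ N *ᵥ y := by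
    have h2 := dotProduct_transpose_mul_mul_mulVec H W⁻¹ x x
    rw [hHt, hHW] at h2
    rw [hR, sub_mulVec, dotProduct_sub, hy, ← h2]
  have h2 := sq_dotProduct_mulVec_le_s8 hA x y
  have h3 : c * (x ⬝ᵥ y) ≤ y ⬝ᵥ A⁻¹ *ᵥ y := by
    refine le_of_mul_le_mul_left ?_ hxA
    nlinarith
  have h4 : (c - 1) * (x ⬝ᵥ y) ≤ v ⬝ᵥ A *ᵥ v := by rw [hvA, ← h1]; linarith
  have h5 : 0 < v ⬝ᵥ A *ᵥ v := lt_of_lt_of_le (mul_pos (by linarith) hxH) h4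
  refine ⟨v, fun h0 => by simp [h0] at h5, ?_⟩
  have h6 := hH.cauchy_schwarz (R *ᵥ v) x
  rw [← hy, hRv, dotProduct_comm, ← hvA, ← hRv] at h6
  refine le_of_mul_le_mul_right ?_ hxH
  nlinarith

lemma exists_mulVec_eq_zero_le_dotProduct_conj {k : Type*} [Fintype k] {A W R : Matrix m m ℝ}
    (hA : A.PosDef) (hW : W.PosDef) (hR : R * A⁻¹ * Rᵀ = A⁻¹ - W⁻¹) {l : ℝ} (hl : 1 ≤ l)
    (hle : ∀ x, l * (x ⬝ᵥ A *ᵥ x) ≤ x ⬝ᵥ W *ᵥ x) (Q : Matrix k m ℝ)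
    (hk : Fintype.card k < Fintype.card m) :
    ∃ v, v ≠ 0 ∧ Q *ᵥ (R *ᵥ v) = 0 ∧
      (l - 1) * (v ⬝ᵥ A *ᵥ v) ≤ (R *ᵥ v) ⬝ᵥ W *ᵥ (R *ᵥ v) := by
  rcases hl.eq_or_lt with rfl | hl1
  · obtain ⟨v, hv, h⟩ := exists_mulVec_eq_zero_of_card_lt (Q * R) hk
    exact ⟨v, hv, by rwa [mulVec_mulVec], by
      simpa only [sub_self, zero_mul] using hW.posSemidef.dotProduct_nonneg _⟩
  have hl0 : 0 < l := by linarith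
  set N := R * A⁻¹ * Rᵀ with hN
  obtain ⟨y, hy0, hy⟩ := exists_mulVec_eq_zero_of_card_lt (Q * N) hk
  set v := A⁻¹ *ᵥ (Rᵀ *ᵥ y) with hv
  have hRv : R *ᵥ v = N *ᵥ y := by rw [hv, hN, ← mulVec_mulVec, ← mulVec_mulVec]
  have hvA : v ⬝ᵥ A *ᵥ v = y ⬝ᵥ N *ᵥ y := by
    rw [hv, hA.mulVec_inv_mulVec, ← hv, dotProduct_mulVec, vecMul_transpose, hRv,
      dotProduct_comm]
  have hWy := hW.inv.dotProduct_pos hy0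
  have h1 := dotProduct_inv_mulVec_le_of_le hA hW (c := 1 / l) (by positivity) (fun x => by
    rw [one_div_mul_eq_div, le_div_iff₀ hl0, mul_comm]; exact hle x) y
  rw [one_div_mul_eq_div, le_div_iff₀ hl0] at h1
  have h2 : (l - 1) * (y ⬝ᵥ W⁻¹ *ᵥ y) ≤ y ⬝ᵥ N *ᵥ y := by
    rw [hR, sub_mulVec, dotProduct_sub]; linarith
  have h3 : 0 < y ⬝ᵥ N *ᵥ y := lt_of_lt_of_le (mul_pos (by linarith) hWy) h2
  refine ⟨v, fun h0 => ?_, ?_, ?_⟩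
  · rw [← hvA, h0] at h3
    simp at h3
  · rw [hRv, mulVec_mulVec, hy]
  · have h4 := sq_dotProduct_mulVec_le_s8 hW (N *ᵥ y) y
    rw [dotProduct_comm] at h4
    rw [hRv, hvA]
    refine le_of_mul_le_mul_right ?_ hWy
    nlinarith

/-- Nonnegativity of `R A⁻¹ Rᵀ = A⁻¹ - W⁻¹` gives `A ≤ W`. -/
lemma dotProduct_le_of_conj_eq_inv_sub_inv {A W R : Matrix m m ℝ} (hA : A.PosDef)
    (hW : W.PosDef) (hR : R * A⁻¹ * Rᵀ = A⁻¹ - W⁻¹) (x : m → ℝ) :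
    x ⬝ᵥ A *ᵥ x ≤ x ⬝ᵥ W *ᵥ x := by
  have hWA : ∀ y, y ⬝ᵥ W⁻¹ *ᵥ y ≤ 1 * (y ⬝ᵥ A⁻¹ *ᵥ y) := fun y => by
    have h1 := hA.inv.posSemidef.dotProduct_nonneg (Rᵀ *ᵥ y)
    rw [← dotProduct_transpose_mul_mul_mulVec, transpose_transpose, hR, sub_mulVec,
      dotProduct_sub] at h1
    linarith
  have h := dotProduct_inv_mulVec_le_of_le hW.inv hA.inv zero_le_one hWA x
  rwa [one_mul, nonsing_inv_nonsing_inv _ ((isUnit_iff_isUnit_det _).1 hA.isUnit),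
    nonsing_inv_nonsing_inv _ ((isUnit_iff_isUnit_det _).1 hW.isUnit)] at h

end Smoother

section GalerkinForms

variable {m k : Type*} [Fintype m] [Fintype k]

lemma dotProduct_coarse_eq (W : Matrix m m ℝ) (hW : W.PosDef) (P : Matrix m k ℝ)
    (T : Matrix k k ℝ) (x : m → ℝ) :
    x ⬝ᵥ (W * P * T * Pᵀ * W) *ᵥ x = (Pᵀ *ᵥ (W *ᵥ x)) ⬝ᵥ T *ᵥ (Pᵀ *ᵥ (W *ᵥ x)) := by
  have hWt : Wᵀ = W := by simpa using hW.isHermitian.eq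
  have h := dotProduct_transpose_mul_mul_mulVec (Pᵀ * W) T x x
  rw [transpose_mul, transpose_transpose, hWt] at h
  rw [mulVec_mulVec x Pᵀ W, ← h]
  simp only [Matrix.mul_assoc]

lemma isHermitian_coarse {W : Matrix m m ℝ} (hW : W.IsHermitian) (P : Matrix m k ℝ)
    {T : Matrix k k ℝ} (hT : T.IsHermitian) : (W * P * T * Pᵀ * W).IsHermitian := by
  have hWt : Wᵀ = W := by simpa using hW.eq
  have hTt : Tᵀ = T := by simpa using hT.eq
  simp only [IsHermitian, conjTranspose_eq_transpose_of_trivial, transpose_mul,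
    transpose_transpose, hWt, hTt, Matrix.mul_assoc]

variable [DecidableEq m]

lemma coarse_mul_inv_mul [DecidableEq k] {W : Matrix m m ℝ} (hW : W.PosDef) (P : Matrix m k ℝ)
    (hX : (Pᵀ * W * P).PosDef) :
    (W * P * (Pᵀ * W * P)⁻¹ * Pᵀ * W) * W⁻¹ * (W * P * (Pᵀ * W * P)⁻¹ * Pᵀ * W) =
      W * P * (Pᵀ * W * P)⁻¹ * Pᵀ * W := by
  rw [Matrix.mul_assoc _ W W⁻¹, hW.mul_inv_cancel, Matrix.mul_one]
  calc _ = W * P * ((Pᵀ * W * P)⁻¹ * (Pᵀ * W * P)) * (Pᵀ * W * P)⁻¹ * Pᵀ * W := by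
        simp only [Matrix.mul_assoc]
    _ = _ := by rw [hX.inv_mul_cancel, Matrix.mul_one]

lemma sub_mul_inv_mul_sub {W H : Matrix m m ℝ} (hW : W.PosDef) (h : H * W⁻¹ * H = H) :
    (W - H) * W⁻¹ * (W - H) = W - H := by
  rw [Matrix.sub_mul, hW.mul_inv_cancel, Matrix.sub_mul, Matrix.one_mul, Matrix.mul_sub, h,
    Matrix.mul_assoc, hW.inv_mul_cancel, Matrix.mul_one]
  abel

lemma posSemidef_of_mul_inv_mul {W H : Matrix m m ℝ} (hW : W.PosDef) (hH : H.IsHermitian)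
    (h : H * W⁻¹ * H = H) : H.PosSemidef := by
  have := hW.inv.posSemidef.conjTranspose_mul_mul_same H
  rwa [hH.eq, h] at this

end GalerkinForms

theorem stmt_8 {n nc : ℕ} (hnc : nc < n)
    (A M : Matrix (Fin n) (Fin n) ℝ)
    (P : Matrix (Fin n) (Fin nc) ℝ)
    (Bc : Matrix (Fin nc) (Fin nc) ℝ)
    (hA : A.PosDef) (hM : IsUnit M.det)
    (hMMA : (M + Mᵀ - A).PosDef)
    (hP : P.rank = nc)
    (hBc : Bc.PosDef)
    (Ac : Matrix (Fin nc) (Fin nc) ℝ) (hAc : Ac = Pᵀ * A * P)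
    (E : Matrix (Fin n) (Fin n) ℝ)
    (hE : E = (1 - Mᵀ⁻¹ * A) * (1 - P * Bc⁻¹ * Pᵀ * A) * (1 - M⁻¹ * A))
    (Mtil : Matrix (Fin n) (Fin n) ℝ)
    (hMtil : Mtil = Mᵀ * (M + Mᵀ - A)⁻¹ * M)
    (Pi : Matrix (Fin n) (Fin n) ℝ) (hPi : Pi = P * (Pᵀ * Mtil * P)⁻¹ * Pᵀ * Mtil)
    (KTG : ℝ)
    (hK : IsGreatest {r : ℝ | ∃ v : Fin n → ℝ, v ≠ 0 ∧
        r = (enorm Mtil ((1 - Pi) *ᵥ v)) ^ 2 / (enorm A v) ^ 2} KTG)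
    (lmaxD lminD : ℝ)
    (hlmaxD : IsGreatest (spectrum ℝ ((Pᵀ * Mtil * P)⁻¹ * (Bc - Ac))) lmaxD)
    (hlminD : IsLeast (spectrum ℝ ((Pᵀ * Mtil * P)⁻¹ * (Bc - Ac))) lminD)
    (d₁ d₂ : ℝ) (hd₁ : d₁ = 1 / (1 + lmaxD)) (hd₂ : d₂ = 1 / (1 + lminD))
    (lamax lamin : ℝ)
    (hlamax : IsGreatest (spectrum ℝ (A⁻¹ * Mtil)) lamax)
    (hlamin : IsLeast (spectrum ℝ (A⁻¹ * Mtil)) lamin)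
    (lbmax : ℝ) (hlbmax : IsGreatest (spectrum ℝ (A⁻¹ * Mtil * Pi)) lbmax)
    (normE : ℝ)
    (hnormE : IsGreatest {r : ℝ | ∃ v : Fin n → ℝ, v ≠ 0 ∧
        r = enorm A (E *ᵥ v) / enorm A v} normE)
    (hcase₁ : d₁ ≤ 1) (hcase₂ : 1 < d₂) (hcase₃ : d₂ < lbmax / (lbmax - 1)) :
    1 - 1 / max lamin (d₂ * KTG + (1 - d₂) * lamax) ≤ normE ∧
      normE ≤ max (1 - 1 / (d₁ * KTG + (1 - d₁) * lamax))
        (1 / ((1 - d₂) * lbmax + d₂) - 1) := by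
  have hAh := hA.isHermitian
  have hAt : Aᵀ = A := by simpa using hAh.eq
  have hPinj : Function.Injective P.mulVec := by
    have h := LinearMap.finrank_range_add_finrank_ker P.mulVecLin
    rw [show Module.finrank ℝ (LinearMap.range P.mulVecLin) = nc from hP] at h
    have hk : LinearMap.ker P.mulVecLin = ⊥ := by
      apply Submodule.finrank_eq_zero.1
      simpa using h
    exact LinearMap.ker_eq_bot.1 hk
  have hMinj : Function.Injective M.mulVec :=
    mulVec_injective_iff_isUnit.2 ((isUnit_iff_isUnit_det _).2 hM)
  have hW : Mtil.PosDef := by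
    have := hMMA.inv.conjTranspose_mul_mul_same hMinj
    rwa [conjTranspose_eq_transpose_of_trivial, ← hMtil] at this
  have hX : (Pᵀ * Mtil * P).PosDef := by
    have := hW.conjTranspose_mul_mul_same hPinj
    rwa [conjTranspose_eq_transpose_of_trivial] at this
  obtain ⟨R, hRdef⟩ : ∃ R, R = 1 - M⁻¹ * A := ⟨_, rfl⟩
  have hR : R * A⁻¹ * Rᵀ = A⁻¹ - Mtil⁻¹ := by
    rw [hRdef, hMtil]
    exact smoother_mul_inv_mul_transpose hA hM hMMA
  have hAW := dotProduct_le_of_conj_eq_inv_sub_inv hA hW hR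
  have hAcX : ∀ z, z ⬝ᵥ Ac *ᵥ z ≤ z ⬝ᵥ (Pᵀ * Mtil * P) *ᵥ z := fun z => by
    rw [hAc, dotProduct_transpose_mul_mul_mulVec, dotProduct_transpose_mul_mul_mulVec]
    exact hAW _
  have hAcH : Ac.IsHermitian := by
    rw [hAc]; exact isHermitian_conjTranspose_mul_mul P hAh
  set X := Pᵀ * Mtil * P with hXdef
  obtain ⟨S, hSdef⟩ : ∃ S, S = X + (Bc - Ac) := ⟨_, rfl⟩
  have hSeq : ∀ z, z ⬝ᵥ S *ᵥ z = z ⬝ᵥ X *ᵥ z + z ⬝ᵥ (Bc - Ac) *ᵥ z := fun z => by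
    rw [hSdef, add_mulVec, dotProduct_add]
  have hS : S.PosDef := by
    refine .of_dotProduct_mulVec_pos
      (by rw [hSdef]; exact hX.isHermitian.add (hBc.isHermitian.sub hAcH)) fun {z} hz => ?_
    have h1 := hSeq z
    rw [sub_mulVec, dotProduct_sub] at h1
    have h2 := hBc.dotProduct_pos hz
    have h3 := hAcX z
    simp only [star_trivial]
    linarith
  -- the spectral equivalence of `S` and `X`
  have hminpos : 0 < 1 + lminD := by
    obtain ⟨z, hz, h⟩ := exists_mulVec_eq_smul_of_mem_spectrum hX hlminD.1
    have h1 := hSeq z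
    rw [h, dotProduct_smul, smul_eq_mul] at h1
    have h2 := hS.dotProduct_pos hz
    have h3 := hX.dotProduct_pos hz
    rw [h1, ← one_add_mul] at h2
    exact pos_of_mul_pos_left h2 h3.le
  have hmaxpos : 0 < 1 + lmaxD := by
    have := hlmaxD.2 hlminD.1
    linarith
  have hd₁pos : 0 < d₁ := by rw [hd₁]; positivity
  have hBA : (Bc - Ac).IsHermitian := hBc.isHermitian.sub hAcH
  have hS₁ : ∀ z, d₁ * (z ⬝ᵥ X⁻¹ *ᵥ z) ≤ z ⬝ᵥ S⁻¹ *ᵥ z := fun z => by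
    have h := dotProduct_inv_mulVec_le_of_le hS hX hmaxpos.le (fun x => by
      have := dotProduct_mulVec_le_of_spectrum_le hX hBA (fun t ht => hlmaxD.2 ht) x
      rw [hSeq]; linarith) z
    rwa [hd₁, one_div_mul_eq_div, div_le_iff₀' hmaxpos]
  have hS₂ : ∀ z, z ⬝ᵥ S⁻¹ *ᵥ z ≤ d₂ * (z ⬝ᵥ X⁻¹ *ᵥ z) := fun z => by
    refine dotProduct_inv_mulVec_le_of_le hX hS (by linarith) (fun x => ?_) z
    have := le_dotProduct_mulVec_of_le_spectrum hX hBA (fun t ht => hlminD.2 ht) x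
    rw [hd₂, one_div_mul_eq_div, le_div_iff₀' hminpos, hSeq]
    linarith
  -- the exact coarse form, its complement, and the inexact complement
  obtain ⟨C, hCdef⟩ : ∃ C, C = Mtil * P * X⁻¹ * Pᵀ * Mtil := ⟨_, rfl⟩
  have hCC : C * Mtil⁻¹ * C = C := by rw [hCdef]; exact coarse_mul_inv_mul hW P hX
  have hCh : C.IsHermitian := by
    rw [hCdef]; exact isHermitian_coarse hW.isHermitian P hX.inv.isHermitian
  have hC : C.PosSemidef := posSemidef_of_mul_inv_mul hW hCh hCC
  obtain ⟨H₀, hH₀def⟩ : ∃ H₀, H₀ = Mtil - C := ⟨_, rfl⟩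
  have hHH : H₀ * Mtil⁻¹ * H₀ = H₀ := by rw [hH₀def]; exact sub_mul_inv_mul_sub hW hCC
  have hH₀h : H₀.IsHermitian := by rw [hH₀def]; exact hW.isHermitian.sub hCh
  have hH₀ : H₀.PosSemidef := posSemidef_of_mul_inv_mul hW hH₀h hHH
  have hH₀eq : ∀ x, x ⬝ᵥ H₀ *ᵥ x = x ⬝ᵥ Mtil *ᵥ x - x ⬝ᵥ C *ᵥ x := fun x => by
    rw [hH₀def, sub_mulVec, dotProduct_sub]
  obtain ⟨H, hHdef⟩ : ∃ H, H = Mtil - Mtil * P * S⁻¹ * Pᵀ * Mtil := ⟨_, rfl⟩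
  have hHeq : ∀ x, x ⬝ᵥ H *ᵥ x = x ⬝ᵥ Mtil *ᵥ x -
      (Pᵀ *ᵥ (Mtil *ᵥ x)) ⬝ᵥ S⁻¹ *ᵥ (Pᵀ *ᵥ (Mtil *ᵥ x)) := fun x => by
    rw [hHdef, sub_mulVec, dotProduct_sub, dotProduct_coarse_eq _ hW]
  have hCeq : ∀ x, x ⬝ᵥ C *ᵥ x =
      (Pᵀ *ᵥ (Mtil *ᵥ x)) ⬝ᵥ X⁻¹ *ᵥ (Pᵀ *ᵥ (Mtil *ᵥ x)) := fun x => by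
    rw [hCdef, dotProduct_coarse_eq _ hW]
  have hHh : H.IsHermitian := by
    rw [hHdef]
    exact hW.isHermitian.sub (isHermitian_coarse hW.isHermitian P hS.inv.isHermitian)
  have hH_le : ∀ x, x ⬝ᵥ H *ᵥ x ≤ d₁ * (x ⬝ᵥ H₀ *ᵥ x) + (1 - d₁) * (x ⬝ᵥ Mtil *ᵥ x) :=
    fun x => by
      rw [hHeq, hH₀eq, hCeq]
      linarith [hS₁ (Pᵀ *ᵥ (Mtil *ᵥ x))]
  have hH_ge : ∀ x, x ⬝ᵥ H₀ *ᵥ x + (1 - d₂) * (x ⬝ᵥ C *ᵥ x) ≤ x ⬝ᵥ H *ᵥ x :=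
    fun x => by
      rw [hHeq, hH₀eq, hCeq]
      linarith [hS₂ (Pᵀ *ᵥ (Mtil *ᵥ x))]
  -- the error propagation matrix as a quadratic form
  obtain ⟨G, hGdef⟩ : ∃ G, G = A - A * P * Bc⁻¹ * Pᵀ * A := ⟨_, rfl⟩
  have hGh : G.IsHermitian := by
    rw [hGdef]; exact hAh.sub (isHermitian_coarse hAh P hBc.inv.isHermitian)
  have hGH : G * (A⁻¹ - Mtil⁻¹) * H = H - G := by
    rw [hGdef, hHdef]
    exact coarse_correction_identity hA hW hBc hS (by rw [hSdef, hAc])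
  have hEeq : E = A⁻¹ * Rᵀ * G * R := by
    have e1 : A⁻¹ * Rᵀ * A = 1 - Mᵀ⁻¹ * A := by
      rw [hRdef, transpose_sub, transpose_mul, transpose_one, hAt, transpose_nonsing_inv,
        Matrix.mul_sub, Matrix.mul_one, ← Matrix.mul_assoc, hA.inv_mul_cancel, Matrix.one_mul,
        Matrix.sub_mul, hA.inv_mul_cancel]
    have e2 : G = A * (1 - P * Bc⁻¹ * Pᵀ * A) := by
      rw [hGdef, Matrix.mul_sub, Matrix.mul_one]
      simp only [Matrix.mul_assoc]
    rw [hE, e2, ← e1, ← hRdef]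
    simp only [Matrix.mul_assoc]
  obtain ⟨Y, hYdef⟩ : ∃ Y, Y = A + Rᵀ * H * R := ⟨_, rfl⟩
  have hYh : Y.IsHermitian := by
    rw [hYdef]; exact hAh.add (isHermitian_conjTranspose_mul_mul R hHh)
  have hYeq : ∀ v, v ⬝ᵥ Y *ᵥ v = v ⬝ᵥ A *ᵥ v + (R *ᵥ v) ⬝ᵥ H *ᵥ (R *ᵥ v) := fun v => by
    rw [hYdef, add_mulVec, dotProduct_add, dotProduct_transpose_mul_mul_mulVec]
  have hinv : (1 - E) * (A⁻¹ * Y) = 1 := by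
    rw [hEeq, hYdef]; exact one_sub_mul_inv_mul_eq_one hA hR hGH
  have hAE : (A * E).IsHermitian := by
    have : A * E = Rᵀ * G * R := by
      rw [hEeq]; simp only [← Matrix.mul_assoc, hA.mul_inv_cancel, Matrix.one_mul]
    rw [this]; exact isHermitian_conjTranspose_mul_mul R hGh
  -- extremal constants
  have hlamin1 : 1 ≤ lamin := by
    obtain ⟨x, hx, h⟩ := exists_mulVec_eq_smul_of_mem_spectrum hA hlamin.1
    have h1 := hAW x
    rw [h, dotProduct_smul, smul_eq_mul] at h1
    have h2 := hA.dotProduct_pos hx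
    exact le_of_mul_le_mul_right (by linarith) h2
  have hlamax1 : 1 ≤ lamax := hlamin1.trans (hlamax.2 hlamin.1)
  have hW_le := dotProduct_mulVec_le_of_spectrum_le hA hW.isHermitian
    (fun t ht => hlamax.2 ht)
  have hW_ge := le_dotProduct_mulVec_of_le_spectrum hA hW.isHermitian
    (fun t ht => hlamin.2 ht)
  have hlb1 : 1 < lbmax := by
    by_contra! h
    rcases h.eq_or_lt with rfl | h
    · norm_num at hcase₃; linarith
    · rw [lt_div_iff_of_neg (by linarith)] at hcase₃
      nlinarith
  have hC_le : ∀ x, x ⬝ᵥ C *ᵥ x ≤ lbmax * (x ⬝ᵥ A *ᵥ x) := by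
    have hPiC : A⁻¹ * Mtil * Pi = A⁻¹ * C := by
      rw [hPi, hCdef]; simp only [Matrix.mul_assoc]
    rw [hPiC] at hlbmax
    exact dotProduct_mulVec_le_of_spectrum_le hA hCh (fun t ht => hlbmax.2 ht)
  have hratio : ∀ v, (_root_.enorm Mtil ((1 - Pi) *ᵥ v)) ^ 2 / (_root_.enorm A v) ^ 2 =
      (v ⬝ᵥ H₀ *ᵥ v) / (v ⬝ᵥ A *ᵥ v) := fun v => by
    rw [energyNorm_sq hW.posSemidef, energyNorm_sq hA.posSemidef]
    have e1 : Mtil * (1 - Pi) = H₀ := by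
      rw [hH₀def, hPi, hCdef, Matrix.mul_sub, Matrix.mul_one]
      simp only [Matrix.mul_assoc]
    have e2 : 1 - Pi = Mtil⁻¹ * H₀ := by
      rw [← e1, ← Matrix.mul_assoc, hW.inv_mul_cancel, Matrix.one_mul]
    have e3 : H₀ᵀ = H₀ := by simpa using hH₀h.eq
    rw [mulVec_mulVec, e1, e2, ← mulVec_mulVec, dotProduct_mulVec, ← mulVec_transpose, e3,
      mulVec_mulVec, mulVec_mulVec, hHH, dotProduct_comm]
  have hH₀_le : ∀ x, x ⬝ᵥ H₀ *ᵥ x ≤ KTG * (x ⬝ᵥ A *ᵥ x) := fun x => by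
    by_cases hx : x = 0
    · simp [hx]
    · rw [← div_le_iff₀ (hA.dotProduct_pos hx)]
      exact hK.2 ⟨x, hx, (hratio x).symm⟩
  obtain ⟨x₀, hx₀, hx₀K⟩ : ∃ x, x ≠ 0 ∧ KTG * (x ⬝ᵥ A *ᵥ x) ≤ x ⬝ᵥ H₀ *ᵥ x := by
    obtain ⟨x, hx, h⟩ := hK.1
    refine ⟨x, hx, ?_⟩
    rw [hratio] at h
    rw [h, div_mul_cancel₀ _ (hA.dotProduct_pos hx).ne']
  have hcard : Fintype.card (Fin nc) < Fintype.card (Fin n) := by simpa using hnc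
  have hK1 : 1 ≤ KTG := by
    obtain ⟨x, hx, h⟩ := exists_mulVec_eq_zero_of_card_lt (Pᵀ * Mtil) hcard
    have h1 := hH₀_le x
    rw [hH₀eq, hCeq, mulVec_mulVec, h, zero_dotProduct, sub_zero] at h1
    exact le_of_mul_le_mul_right (by linarith [hAW x]) (hA.dotProduct_pos hx)
  -- bounds for the conjugated forms
  have hRW := dotProduct_conj_le_sub_one hA hW.posSemidef hR
    (by rw [hW.mul_inv_cancel, Matrix.one_mul]) hlamax1 hW_le
  have hRH₀ := dotProduct_conj_le_sub_one hA hH₀ hR hHH hK1 hH₀_le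
  have hRC := dotProduct_conj_le_sub_one hA hC hR hCC hlb1.le hC_le
  have hlowpos : 0 < (1 - d₂) * lbmax + d₂ := by
    rw [lt_div_iff₀ (by linarith)] at hcase₃
    linarith
  have hY_le : ∀ v, v ⬝ᵥ Y *ᵥ v ≤ (d₁ * KTG + (1 - d₁) * lamax) * (v ⬝ᵥ A *ᵥ v) := fun v => by
    have h1 := mul_le_mul_of_nonneg_left (hRH₀ v) hd₁pos.le
    have h2 := mul_le_mul_of_nonneg_left (hRW v) (sub_nonneg.2 hcase₁)
    have h3 := hH_le (R *ᵥ v)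
    rw [hYeq]
    linarith
  have hY_ge : ∀ v, ((1 - d₂) * lbmax + d₂) * (v ⬝ᵥ A *ᵥ v) ≤ v ⬝ᵥ Y *ᵥ v := fun v => by
    have h1 := mul_le_mul_of_nonneg_left (hRC v) (sub_nonneg.2 hcase₂.le)
    have h2 := hH₀.dotProduct_nonneg (R *ᵥ v)
    have h3 := hH_ge (R *ᵥ v)
    rw [hYeq]
    linarith
  have hY : Y.PosSemidef := .of_dotProduct_mulVec_nonneg hYh fun v => by
    have h1 := hA.posSemidef.dotProduct_nonneg v
    simpa only [star_trivial] using (mul_nonneg hlowpos.le h1).trans (hY_ge v)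
  constructor
  · have hμ : 0 < max lamin (d₂ * KTG + (1 - d₂) * lamax) :=
      lt_max_of_lt_left (by linarith)
    obtain ⟨w, hw, h⟩ := exists_le_dotProduct_error hA hinv hμ (by
      rcases max_choice lamin (d₂ * KTG + (1 - d₂) * lamax) with h | h
      · rw [h]
        obtain ⟨v, hv, h1, h2⟩ := exists_mulVec_eq_zero_le_dotProduct_conj hA hW hR hlamin1 hW_ge
          (Pᵀ * Mtil) hcard
        refine ⟨v, hv, ?_⟩
        rw [hYeq, hHeq, mulVec_mulVec _ Pᵀ, h1, zero_dotProduct]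
        linarith
      · rw [h]
        obtain ⟨v, hv, h1⟩ := exists_le_dotProduct_conj hA hH₀ hR hHH hK1 hx₀ hx₀K
        refine ⟨v, hv, ?_⟩
        have h2 := hH_ge (R *ᵥ v)
        have h3 := hH₀eq (R *ᵥ v)
        have h4 := mul_le_mul_of_nonneg_left (hRW v) (sub_nonneg.2 hcase₂.le)
        have h5 := mul_le_mul_of_nonneg_left h1 (zero_le_one.trans hcase₂.le)
        rw [hYeq]
        nlinarith)
    exact (le_energyNorm_mulVec_div hA hw h).trans (hnormE.2 ⟨w, hw, rfl⟩)
  · obtain ⟨v, hv, hvE⟩ := hnormE.1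
    have hvA := hA.dotProduct_pos hv
    have hup : 0 < d₁ * KTG + (1 - d₁) * lamax := by
      have := (mul_pos hlowpos hvA).trans_le ((hY_ge v).trans (hY_le v))
      exact pos_of_mul_pos_left this hvA.le
    have hlow1 : (1 - d₂) * lbmax + d₂ < 1 := by nlinarith
    have hU₂ : 0 < 1 / ((1 - d₂) * lbmax + d₂) - 1 := by
      rw [sub_pos, lt_div_iff₀ hlowpos]; linarith
    rw [hvE, div_le_iff₀ (energyNorm_pos hA hv)]
    refine energyNorm_mulVec_le hA hAE (lt_max_of_lt_right hU₂) (fun w => ?_) (fun w => ?_) v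
    · exact (dotProduct_error_le hA hY hinv hup hY_le w).trans
        (mul_le_mul_of_nonneg_right (le_max_left _ _) (hA.posSemidef.dotProduct_nonneg w))
    · refine le_trans ?_ (le_dotProduct_error hA hinv hlowpos hY_ge w)
      refine mul_le_mul_of_nonneg_right ?_ (hA.posSemidef.dotProduct_nonneg w)
      linarith [le_max_right (1 - 1 / (d₁ * KTG + (1 - d₁) * lamax))
        (1 / ((1 - d₂) * lbmax + d₂) - 1)]
end

section
/- Let A ∈ ℝ^{n×n} be SPD, M ∈ ℝ^{n×n} nonsingular with M + Mᵀ − A SPD, P ∈ ℝ^{n×n_c} of full column rank, A_c := PᵀAP, B_c ∈ ℝ^{n_c×n_c} SPD, and let E_ITG = (I−M^{-T}A)(I−P B_c^{-1}PᵀA)(I−M^{-1}A). Set M̃ := Mᵀ(M+Mᵀ−A)^{-1}M, Π_M̃ := P(PᵀM̃P)^{-1}PᵀM̃, K_TG := max_{v≠0} ‖(I−Π_M̃)v‖²_M̃/‖v‖²_A, d₁ := 1/(1+λ_max((PᵀM̃P)^{-1}(B_c−A_c))), d₂ := 1/(1+λ_min((PᵀM̃P)^{-1}(B_c−A_c))).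 If 1 < d₁ ≤ d₂ < λ_max(A^{-1}M̃Π_M̃)/(λ_max(A^{-1}M̃Π_M̃)−1), then max{L₂, L₃} ≤ ‖E_ITG‖_A ≤ U₃, where L₂ = 1 − 1/max{λ_min(A^{-1}M̃), d₂K_TG + (1−d₂)λ_max(A^{-1}M̃)}, L₃ = 1/(min{λ_max(A^{-1}M̃) − d₁λ_max(A^{-1}M̃Π_M̃), (1−d₁)λ_min(A^{-1}M̃)} + d₁) − 1, and U₃ = max{1 − 1/K_TG, 1/((1−d₂)λ_max(A^{-1}M̃Π_M̃) + d₂) − 1}. -/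
open Matrix

/-- The top eigenpair of a symmetric-definite pencil maximises the Rayleigh quotient. -/
lemma exists_top_eigenpair {m : Type*} [Fintype m] [Nonempty m] {A H : Matrix m m ℝ}
    (hA : A.PosDef) (hH : H.IsSymm) :
    ∃ (μ : ℝ) (v : m → ℝ), v ≠ 0 ∧ H *ᵥ v = μ • (A *ᵥ v) ∧
      ∀ w, w ⬝ᵥ (H *ᵥ w) ≤ μ * (w ⬝ᵥ (A *ᵥ w)) := by
  have hpos : ∀ v : m → ℝ, v ≠ 0 → 0 < v ⬝ᵥ (A *ᵥ v) := fun v hv => by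
    simpa using hA.dotProduct_mulVec_pos hv
  have hne0 : ∀ v ∈ Metric.sphere (0 : m → ℝ) 1, v ≠ 0 := by
    rintro v hv rfl
    simp at hv
  obtain ⟨v, hvS, hmax⟩ := (isCompact_sphere (0 : m → ℝ) 1).exists_isMaxOn
    (f := fun v => (v ⬝ᵥ (H *ᵥ v)) / (v ⬝ᵥ (A *ᵥ v)))
    (NormedSpace.sphere_nonempty.mpr zero_le_one)
    (ContinuousOn.div (by fun_prop) (by fun_prop) fun v hv => (hpos v (hne0 v hv)).ne')
  have hv := hne0 v hvS
  set μ := (v ⬝ᵥ (H *ᵥ v)) / (v ⬝ᵥ (A *ᵥ v)) with hμ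
  have hle : ∀ w, w ⬝ᵥ (H *ᵥ w) ≤ μ * (w ⬝ᵥ (A *ᵥ w)) := by
    intro w
    rcases eq_or_ne w 0 with rfl | hw
    · simp
    have hn : ‖w‖ ≠ 0 := norm_ne_zero_iff.mpr hw
    have h := hmax (show ‖w‖⁻¹ • w ∈ Metric.sphere (0 : m → ℝ) 1 by
      simp [norm_smul, hn])
    simp only [Set.mem_ofPred_eq, mulVec_smul, smul_dotProduct, dotProduct_smul, smul_eq_mul] at h
    rw [mul_div_mul_left _ _ (inv_ne_zero hn), mul_div_mul_left _ _ (inv_ne_zero hn)] at h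
    exact (div_le_iff₀ (hpos w hw)).mp h
  have hpsd : (μ • A - H).PosSemidef := by
    refine .of_dotProduct_mulVec_nonneg ?_ fun w => ?_
    · have h := hA.isHermitian.eq
      simp only [conjTranspose_eq_transpose_of_trivial] at h
      simp [IsHermitian, h, hH.eq]
    · have := hle w
      simp [sub_mulVec, smul_mulVec, dotProduct_sub]
      linarith
  refine ⟨μ, v, hv, ?_, hle⟩
  have h0 := (hpsd.dotProduct_mulVec_zero_iff v).mp (by
    simp [sub_mulVec, smul_mulVec, dotProduct_sub, hμ, (hpos v hv).ne'])
  rw [sub_mulVec, smul_mulVec, sub_eq_zero] at h0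
  exact h0.symm

lemma exists_bot_eigenpair {m : Type*} [Fintype m] [Nonempty m] {A H : Matrix m m ℝ}
    (hA : A.PosDef) (hH : H.IsSymm) :
    ∃ (μ : ℝ) (v : m → ℝ), v ≠ 0 ∧ H *ᵥ v = μ • (A *ᵥ v) ∧
      ∀ w, μ * (w ⬝ᵥ (A *ᵥ w)) ≤ w ⬝ᵥ (H *ᵥ w) := by
  obtain ⟨μ, v, hv, h, hle⟩ := exists_top_eigenpair hA hH.neg
  refine ⟨-μ, v, hv, ?_, fun w => ?_⟩
  · rw [neg_mulVec] at h
    rw [neg_smul, ← h, neg_neg]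
  · have := hle w
    rw [neg_mulVec, dotProduct_neg] at this
    linarith

lemma mem_spectrum_inv_mul_iff {m : Type*} [Fintype m] [DecidableEq m] {A H : Matrix m m ℝ}
    (hA : IsUnit A.det) {μ : ℝ} :
    μ ∈ spectrum ℝ (A⁻¹ * H) ↔ ∃ v, v ≠ 0 ∧ H *ᵥ v = μ • (A *ᵥ v) := by
  rw [spectrum.mem_iff, isUnit_iff_isUnit_det, isUnit_iff_ne_zero, not_not,
    ← exists_mulVec_eq_zero_iff]
  refine exists_congr fun v => and_congr_right fun _ => ?_
  rw [sub_mulVec, Algebra.algebraMap_eq_smul_one, smul_mulVec, one_mulVec, sub_eq_zero,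
    ← mulVec_mulVec]
  constructor
  · intro h
    rw [← mulVec_smul, h, mulVec_mulVec, mul_nonsing_inv _ hA, one_mulVec]
  · intro h
    rw [h, mulVec_smul, mulVec_mulVec, nonsing_inv_mul _ hA, one_mulVec]

lemma quadForm_le_of_isGreatest_spectrum {m : Type*} [Fintype m] [DecidableEq m]
    {A H : Matrix m m ℝ} (hA : A.PosDef) (hH : H.IsSymm) {l : ℝ}
    (hl : IsGreatest (spectrum ℝ (A⁻¹ * H)) l) (w : m → ℝ) :
    w ⬝ᵥ (H *ᵥ w) ≤ l * (w ⬝ᵥ (A *ᵥ w)) := by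
  rcases isEmpty_or_nonempty m with hm | hm
  · simp [dotProduct]
  obtain ⟨μ, v, hv, h, hle⟩ := exists_top_eigenpair hA hH
  have hμ := hl.2 ((mem_spectrum_inv_mul_iff ((isUnit_iff_isUnit_det A).mp hA.isUnit)).mpr ⟨v, hv, h⟩)
  have h0 : 0 ≤ w ⬝ᵥ (A *ᵥ w) := by simpa using hA.posSemidef.dotProduct_mulVec_nonneg w
  exact (hle w).trans (mul_le_mul_of_nonneg_right hμ h0)

lemma le_quadForm_of_isLeast_spectrum {m : Type*} [Fintype m] [DecidableEq m]
    {A H : Matrix m m ℝ} (hA : A.PosDef) (hH : H.IsSymm) {l : ℝ}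
    (hl : IsLeast (spectrum ℝ (A⁻¹ * H)) l) (w : m → ℝ) :
    l * (w ⬝ᵥ (A *ᵥ w)) ≤ w ⬝ᵥ (H *ᵥ w) := by
  rcases isEmpty_or_nonempty m with hm | hm
  · simp [dotProduct]
  obtain ⟨μ, v, hv, h, hle⟩ := exists_bot_eigenpair hA hH
  have hμ := hl.2 ((mem_spectrum_inv_mul_iff ((isUnit_iff_isUnit_det A).mp hA.isUnit)).mpr ⟨v, hv, h⟩)
  have h0 : 0 ≤ w ⬝ᵥ (A *ᵥ w) := by simpa using hA.posSemidef.dotProduct_mulVec_nonneg w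
  exact (mul_le_mul_of_nonneg_right hμ h0).trans (hle w)

/-- Inversion reverses the Loewner order, up to a scalar factor. -/
lemma inv_quadForm_le_of_quadForm_le {m : Type*} [Fintype m] [DecidableEq m]
    {D G : Matrix m m ℝ} (hD : D.PosDef) (hG : G.PosDef) {c : ℝ} (hc : 0 < c)
    (h : ∀ u, u ⬝ᵥ (D *ᵥ u) ≤ c * (u ⬝ᵥ (G *ᵥ u))) (z : m → ℝ) :
    z ⬝ᵥ (G⁻¹ *ᵥ z) ≤ c * (z ⬝ᵥ (D⁻¹ *ᵥ z)) := by
  have hGu := (isUnit_iff_isUnit_det G).mp hG.isUnit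
  have hDu := (isUnit_iff_isUnit_det D).mp hD.isUnit
  obtain ⟨u, hu⟩ : ∃ u, G⁻¹ *ᵥ z = u := ⟨_, rfl⟩
  obtain ⟨x, hx⟩ : ∃ x, D⁻¹ *ᵥ z = x := ⟨_, rfl⟩
  have hGz : G *ᵥ u = z := by rw [← hu, mulVec_mulVec, mul_nonsing_inv _ hGu, one_mulVec]
  have hDz : D *ᵥ x = z := by rw [← hx, mulVec_mulVec, mul_nonsing_inv _ hDu, one_mulVec]
  have hDs : Dᵀ = D := by simpa using hD.isHermitian.eq
  have hsym : x ⬝ᵥ (D *ᵥ u) = z ⬝ᵥ u := by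
    rw [dotProduct_mulVec, ← mulVec_transpose, hDs, hDz]
  have h1 : 0 ≤ (u - c • x) ⬝ᵥ (D *ᵥ (u - c • x)) := by
    simpa using hD.posSemidef.dotProduct_mulVec_nonneg (u - c • x)
  have h2 := h u
  simp only [mulVec_sub, mulVec_smul, sub_dotProduct, dotProduct_sub, smul_dotProduct,
    dotProduct_smul, smul_eq_mul, hDz, hsym] at h1
  rw [hGz, dotProduct_comm u z] at h2
  rw [dotProduct_comm u z, dotProduct_comm x z] at h1
  rw [hu, hx]
  refine le_of_mul_le_mul_left ?_ hc
  nlinarith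

lemma isSymm_of_posDef {m : Type*} {B : Matrix m m ℝ} (hB : B.PosDef) : B.IsSymm := by
  have h := hB.isHermitian.eq
  rwa [conjTranspose_eq_transpose_of_trivial] at h

lemma exists_eigenpair_add_one {m : Type*} [Fintype m] [DecidableEq m] {A M Q : Matrix m m ℝ}
    (hA : IsUnit A.det) (hM : IsUnit M.det) (hQ : Q * (M + Mᵀ - A) * Q = Q) {c : ℝ} (hc : c ≠ 0)
    (h : ∃ v, v ≠ 0 ∧ ((Mᵀ - A) * Q * (M - A)) *ᵥ v = c • (A *ᵥ v)) :
    ∃ w, w ≠ 0 ∧ (Mᵀ * Q * M) *ᵥ w = (c + 1) • (A *ᵥ w) := by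
  obtain ⟨v, hv, h⟩ := h
  obtain ⟨y, hy⟩ : ∃ y, Q *ᵥ ((M - A) *ᵥ v) = y := ⟨_, rfl⟩
  have h1 : (Mᵀ - A) *ᵥ y = c • (A *ᵥ v) := by
    rw [← h, ← hy]; simp only [mulVec_mulVec, Matrix.mul_assoc]
  have hQy : Q *ᵥ ((M + Mᵀ - A) *ᵥ y) = y := by
    rw [← hy]; simp only [mulVec_mulVec, ← Matrix.mul_assoc]; rw [hQ]
  have hAinj := mulVec_injective_of_det_ne_zero hA.ne_zero
  have hMinj := mulVec_injective_of_det_ne_zero (isUnit_det_transpose _ hM).ne_zero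
  have hy0 : y ≠ 0 := by
    rintro rfl
    rw [mulVec_zero, eq_comm, smul_eq_zero, or_iff_right hc] at h1
    exact hv (hAinj (h1.trans (mulVec_zero A).symm))
  have hAw : A *ᵥ (c • v + y) = Mᵀ *ᵥ y := by
    rw [mulVec_add, mulVec_smul, ← h1, sub_mulVec, sub_add_cancel]
  have hQw : Q *ᵥ (M *ᵥ (c • v + y)) = (c + 1) • y := by
    have h2 : M *ᵥ (c • v + y) = c • ((M - A) *ᵥ v) + (M + Mᵀ - A) *ᵥ y := by
      have h3 : M *ᵥ (c • v + y) =
          (M *ᵥ (c • v + y) - A *ᵥ (c • v + y)) + Mᵀ *ᵥ y := by rw [hAw, sub_add_cancel]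
      rw [h3]
      simp only [mulVec_add, mulVec_smul, sub_mulVec, add_mulVec, smul_sub]
      abel
    rw [h2, mulVec_add, mulVec_smul, hy, hQy, add_smul, one_smul]
  refine ⟨c • v + y, fun h0 => hy0 ?_, ?_⟩
  · rw [h0, mulVec_zero] at hAw
    exact hMinj (hAw.symm.trans (mulVec_zero _).symm)
  · rw [← mulVec_mulVec, ← mulVec_mulVec, hQw, mulVec_smul, hAw]

lemma exists_eigenpair_sub_one {m : Type*} [Fintype m] [DecidableEq m] {A M Q : Matrix m m ℝ}
    (hA : IsUnit A.det) (hQ : Q * (M + Mᵀ - A) * Q = Q) {κ : ℝ}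
    (hκ : κ ≠ 0) (hκ1 : κ ≠ 1)
    (h : ∃ w, w ≠ 0 ∧ (Mᵀ * Q * M) *ᵥ w = κ • (A *ᵥ w)) :
    ∃ v, v ≠ 0 ∧ ((Mᵀ - A) * Q * (M - A)) *ᵥ v = (κ - 1) • (A *ᵥ v) := by
  obtain ⟨w, hw, h⟩ := h
  obtain ⟨y, hy⟩ : ∃ y, Q *ᵥ (M *ᵥ w) = y := ⟨_, rfl⟩
  have h1 : Mᵀ *ᵥ y = κ • (A *ᵥ w) := by
    rw [← h, ← hy]; simp only [mulVec_mulVec, Matrix.mul_assoc]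
  have hQy : Q *ᵥ ((M + Mᵀ - A) *ᵥ y) = y := by
    rw [← hy]; simp only [mulVec_mulVec, ← Matrix.mul_assoc]; rw [hQ]
  have hAinj := mulVec_injective_of_det_ne_zero hA.ne_zero
  have hy0 : y ≠ 0 := by
    rintro rfl
    rw [mulVec_zero, eq_comm, smul_eq_zero, or_iff_right hκ] at h1
    exact hw (hAinj (h1.trans (mulVec_zero A).symm))
  have hAv : A *ᵥ (κ • w - y) = (Mᵀ - A) *ᵥ y := by
    rw [mulVec_sub, mulVec_smul, ← h1, sub_mulVec]
  have hQv : Q *ᵥ ((M - A) *ᵥ (κ • w - y)) = (κ - 1) • y := by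
    have h2 : (M - A) *ᵥ (κ • w - y) = κ • (M *ᵥ w) - (M + Mᵀ - A) *ᵥ y := by
      rw [sub_mulVec, hAv]
      simp only [mulVec_sub, mulVec_smul, sub_mulVec, add_mulVec]
      abel
    rw [h2, mulVec_sub, mulVec_smul, hy, hQy, sub_smul, one_smul]
  refine ⟨κ • w - y, fun h0 => ?_, ?_⟩
  · rw [h0, mulVec_zero, mulVec_zero, eq_comm, smul_eq_zero] at hQv
    exact hQv.elim (sub_ne_zero.mpr hκ1) hy0
  · rw [← mulVec_mulVec, ← mulVec_mulVec, hQv, mulVec_smul, hAv]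

lemma sub_mul_inv_mul_sub_s9 {m : Type*} [Fintype m] [DecidableEq m] {A M : Matrix m m ℝ}
    (hN : IsUnit (M + Mᵀ - A).det) :
    (Mᵀ - A) * (M + Mᵀ - A)⁻¹ * (M - A) = M * (M + Mᵀ - A)⁻¹ * Mᵀ - A := by
  obtain ⟨N, hNd⟩ : ∃ N, M + Mᵀ - A = N := ⟨_, rfl⟩
  rw [hNd] at hN ⊢
  have h1 : Mᵀ - A = N - M := by rw [← hNd]; abel
  have h2 : M - A = N - Mᵀ := by rw [← hNd]; abel
  rw [h1, h2, Matrix.sub_mul, mul_nonsing_inv _ hN, Matrix.sub_mul, Matrix.one_mul,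
    Matrix.mul_sub, nonsing_inv_mul_cancel_right _ _ hN, ← hNd]
  abel

lemma sub_mul_inv_mul_sub' {m : Type*} [Fintype m] [DecidableEq m] {A M : Matrix m m ℝ}
    (hN : IsUnit (M + Mᵀ - A).det) :
    (M - A) * (M + Mᵀ - A)⁻¹ * (Mᵀ - A) = Mᵀ * (M + Mᵀ - A)⁻¹ * M - A := by
  have h : M + Mᵀ - A = Mᵀ + Mᵀᵀ - A := by rw [transpose_transpose, add_comm]
  have := sub_mul_inv_mul_sub_s9 (M := Mᵀ) (A := A) (by rwa [← h])
  rwa [← h, transpose_transpose] at this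

/-- The two symmetrised smoothers have the same spectrum relative to `A`. -/
lemma spectrum_inv_mul_symmetrized_comm {m : Type*} [Fintype m] [DecidableEq m]
    {A M : Matrix m m ℝ} (hA : IsUnit A.det) (hN : IsUnit (M + Mᵀ - A).det) :
    spectrum ℝ (A⁻¹ * (M * (M + Mᵀ - A)⁻¹ * Mᵀ)) =
      spectrum ℝ (A⁻¹ * (Mᵀ * (M + Mᵀ - A)⁻¹ * M)) := by
  have key : (A⁻¹ * (M * (M + Mᵀ - A)⁻¹ * Mᵀ) - 1).charpoly.IsRoot =
      ((M + Mᵀ - A)⁻¹ * (M * A⁻¹ * Mᵀ) - 1).charpoly.IsRoot := by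
    have h1 : A⁻¹ * (M * (M + Mᵀ - A)⁻¹ * Mᵀ) - 1 =
        (A⁻¹ * (Mᵀ - A)) * ((M + Mᵀ - A)⁻¹ * (M - A)) := by
      rw [Matrix.mul_assoc A⁻¹, ← Matrix.mul_assoc (Mᵀ - A), sub_mul_inv_mul_sub_s9 hN,
        Matrix.mul_sub, nonsing_inv_mul _ hA]
    have h2 : ((M + Mᵀ - A)⁻¹ * (M - A)) * (A⁻¹ * (Mᵀ - A)) =
        (M + Mᵀ - A)⁻¹ * (M * A⁻¹ * Mᵀ) - 1 := by
      have h3 : (M - A) * (A⁻¹ * (Mᵀ - A)) = M * A⁻¹ * Mᵀ - (M + Mᵀ - A) := by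
        rw [Matrix.mul_sub, nonsing_inv_mul _ hA, Matrix.sub_mul, Matrix.mul_sub, Matrix.mul_sub,
          mul_nonsing_inv_cancel_left _ _ hA, Matrix.mul_one, Matrix.mul_one, Matrix.mul_assoc]
        abel
      rw [Matrix.mul_assoc, h3, Matrix.mul_sub, nonsing_inv_mul _ hN]
    rw [h1, charpoly_mul_comm, h2]
  have hspec : ∀ X Y : Matrix m m ℝ, X.charpoly.IsRoot = Y.charpoly.IsRoot →
      spectrum ℝ X = spectrum ℝ Y := fun X Y h => by
    ext μ
    rw [mem_spectrum_iff_isRoot_charpoly, mem_spectrum_iff_isRoot_charpoly, h]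
  have hcomm : spectrum ℝ ((M + Mᵀ - A)⁻¹ * (M * A⁻¹ * Mᵀ)) =
      spectrum ℝ (A⁻¹ * (Mᵀ * (M + Mᵀ - A)⁻¹ * M)) := by
    refine hspec _ _ ?_
    rw [Matrix.mul_assoc M, ← Matrix.mul_assoc _ M, charpoly_mul_comm]
    simp only [Matrix.mul_assoc]
  have hshift : ∀ (X : Matrix m m ℝ) (μ : ℝ), μ ∈ spectrum ℝ X ↔ μ - 1 ∈ spectrum ℝ (X - 1) := by
    intro X μ
    rw [spectrum.mem_iff, spectrum.mem_iff, map_sub, map_one, sub_sub_sub_cancel_right]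
  rw [← hcomm]
  ext μ
  rw [hshift (A⁻¹ * _), hshift ((M + Mᵀ - A)⁻¹ * _), hspec _ _ key]

lemma enorm_smul_eq {m : Type*} [Fintype m] (G : Matrix m m ℝ) (c : ℝ) (v : m → ℝ) :
    enorm G (c • v) = |c| * enorm G v := by
  rw [_root_.enorm, _root_.enorm, mulVec_smul, smul_dotProduct, dotProduct_smul, smul_eq_mul, smul_eq_mul,
    ← mul_assoc, Real.sqrt_mul (mul_self_nonneg c), Real.sqrt_mul_self_eq_abs]

lemma abs_eigenvalue_le_energyNorm {m : Type*} [Fintype m] {A E : Matrix m m ℝ} {ρ : ℝ}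
    (hA : A.PosDef)
    (hρ : ρ ∈ upperBounds {r : ℝ | ∃ v : m → ℝ, v ≠ 0 ∧ r = enorm A (E *ᵥ v) / enorm A v})
    {l : ℝ} {v : m → ℝ} (hv : v ≠ 0) (h : E *ᵥ v = l • v) : |l| ≤ ρ := by
  refine hρ ⟨v, hv, ?_⟩
  have hpos : 0 < v ⬝ᵥ (A *ᵥ v) := by simpa using hA.dotProduct_mulVec_pos hv
  rw [h, enorm_smul_eq, mul_div_cancel_right₀]
  exact (Real.sqrt_pos.mpr hpos).ne'

section EnergyNorm

variable {m : Type*} [Fintype m] [DecidableEq m] {A B E : Matrix m m ℝ} {ρ : ℝ}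

lemma mulVec_eq_of_eigenpair (hB : IsUnit B.det) (hBE : B * (1 - E) = A) {μ : ℝ} (hμ : μ ≠ 0)
    {v : m → ℝ} (h : B *ᵥ v = μ • (A *ᵥ v)) : E *ᵥ v = (1 - 1 / μ) • v := by
  have h1 : v = μ • (v - E *ᵥ v) := by
    apply mulVec_injective_of_det_ne_zero hB.ne_zero
    rw [mulVec_smul, h, ← hBE, ← mulVec_mulVec, sub_mulVec, one_mulVec]
  have h2 : (1 / μ) • v = v - E *ᵥ v := by
    nth_rewrite 1 [h1]
    rw [smul_smul, one_div_mul_cancel hμ, one_smul]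
  rw [sub_smul, one_smul, h2, sub_sub_cancel]

lemma one_sub_one_div_le_energyNorm (hA : A.PosDef) (hB : B.PosDef) (hBE : B * (1 - E) = A)
    (hρ : ρ ∈ upperBounds {r : ℝ | ∃ v : m → ℝ, v ≠ 0 ∧ r = enorm A (E *ᵥ v) / enorm A v})
    {x : ℝ} (hx : 0 < x) {v : m → ℝ} (hv : v ≠ 0)
    (h : x * (v ⬝ᵥ (A *ᵥ v)) ≤ v ⬝ᵥ (B *ᵥ v)) : 1 - 1 / x ≤ ρ := by
  have : Nonempty m := (Function.ne_iff.mp hv).nonempty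
  obtain ⟨μ, u, hu, hμu, hle⟩ := exists_top_eigenpair hA (isSymm_of_posDef hB)
  have hpos : 0 < v ⬝ᵥ (A *ᵥ v) := by simpa using hA.dotProduct_mulVec_pos hv
  have hxμ : x ≤ μ := le_of_mul_le_mul_right (h.trans (hle v)) hpos
  have hE := mulVec_eq_of_eigenpair ((isUnit_iff_isUnit_det B).mp hB.isUnit) hBE
    (hx.trans_le hxμ).ne' hμu
  have h1 := one_div_le_one_div_of_le hx hxμ
  have h2 := (le_abs_self _).trans (abs_eigenvalue_le_energyNorm hA hρ hu hE)
  linarith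

lemma one_div_sub_one_le_energyNorm (hA : A.PosDef) (hB : B.PosDef) (hBE : B * (1 - E) = A)
    (hρ : ρ ∈ upperBounds {r : ℝ | ∃ v : m → ℝ, v ≠ 0 ∧ r = enorm A (E *ᵥ v) / enorm A v})
    {y : ℝ} {v : m → ℝ} (hv : v ≠ 0)
    (h : v ⬝ᵥ (B *ᵥ v) ≤ y * (v ⬝ᵥ (A *ᵥ v))) : 1 / y - 1 ≤ ρ := by
  have : Nonempty m := (Function.ne_iff.mp hv).nonempty
  obtain ⟨μ, u, hu, hμu, hle⟩ := exists_bot_eigenpair hA (isSymm_of_posDef hB)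
  have hpos : 0 < v ⬝ᵥ (A *ᵥ v) := by simpa using hA.dotProduct_mulVec_pos hv
  have hμy : μ ≤ y := le_of_mul_le_mul_right ((hle v).trans h) hpos
  have hu1 : 0 < u ⬝ᵥ (A *ᵥ u) := by simpa using hA.dotProduct_mulVec_pos hu
  have hu2 : 0 < u ⬝ᵥ (B *ᵥ u) := by simpa using hB.dotProduct_mulVec_pos hu
  rw [hμu, dotProduct_smul, smul_eq_mul] at hu2
  have hμ : 0 < μ := pos_of_mul_pos_left hu2 hu1.le
  have hE := mulVec_eq_of_eigenpair ((isUnit_iff_isUnit_det B).mp hB.isUnit) hBE hμ.ne' hμu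
  have h1 := one_div_le_one_div_of_le hμ hμy
  have h2 := (neg_abs_le _).trans' (neg_le_neg (abs_eigenvalue_le_energyNorm hA hρ hu hE))
  linarith

lemma energyNorm_le_of_quadForm_bounds (hA : A.PosDef) (hB : B.IsSymm) (hBE : B * (1 - E) = A)
    (hρ : ρ ∈ {r : ℝ | ∃ v : m → ℝ, v ≠ 0 ∧ r = enorm A (E *ᵥ v) / enorm A v})
    {α κ : ℝ} (hα : 0 < α) (hlow : ∀ v, α * (v ⬝ᵥ (A *ᵥ v)) ≤ v ⬝ᵥ (B *ᵥ v))
    (hupp : ∀ v, v ⬝ᵥ (B *ᵥ v) ≤ κ * (v ⬝ᵥ (A *ᵥ v))) :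
    ρ ≤ max (1 - 1 / κ) (1 / α - 1) := by
  obtain ⟨w, hw, rfl⟩ := hρ
  have : Nonempty m := (Function.ne_iff.mp hw).nonempty
  have hpos : ∀ v : m → ℝ, v ≠ 0 → 0 < v ⬝ᵥ (A *ᵥ v) := fun v hv => by
    simpa using hA.dotProduct_mulVec_pos hv
  have hAs : Aᵀ = A := by simpa using hA.isHermitian.eq
  set r := max (1 - 1 / κ) (1 / α - 1)
  have heig : ∀ (l : ℝ) (v : m → ℝ), v ≠ 0 → E *ᵥ v = l • v → |l| ≤ r := by
    intro l v hv h
    have hav := hpos v hv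
    have h1 : v ⬝ᵥ (A *ᵥ v) = (1 - l) * (v ⬝ᵥ (B *ᵥ v)) := by
      conv_lhs => rw [← hBE, ← mulVec_mulVec, sub_mulVec, one_mulVec, h]
      rw [mulVec_sub, mulVec_smul, dotProduct_sub, dotProduct_smul, smul_eq_mul]
      ring
    have h2 := hlow v
    have h3 := hupp v
    have hbv : 0 < v ⬝ᵥ (B *ᵥ v) := (mul_pos hα hav).trans_le h2
    have hκ : 0 < κ := pos_of_mul_pos_left (hbv.trans_le h3) hav.le
    have hl : 1 - l = v ⬝ᵥ (A *ᵥ v) / v ⬝ᵥ (B *ᵥ v) := by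
      rw [h1, mul_div_cancel_right₀ _ hbv.ne']
    have h4 : 1 - l ≤ 1 / α := by
      rw [hl, div_le_div_iff₀ hbv hα]; linarith
    have h5 : 1 / κ ≤ 1 - l := by
      rw [hl, div_le_div_iff₀ hκ hbv]; linarith
    have h6 := le_max_left (1 - 1 / κ) (1 / α - 1)
    have h7 := le_max_right (1 - 1 / κ) (1 / α - 1)
    rw [abs_le]
    constructor <;> linarith
  have hsymm : Eᵀ * A = A * E := by
    have h1 : (1 - E)ᵀ * A = A * (1 - E) := by
      have h2 : A = (1 - E)ᵀ * B := by
        conv_lhs => rw [← hAs, ← hBE, transpose_mul, hB.eq]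
      conv_rhs => rw [h2]
      rw [Matrix.mul_assoc, hBE]
    rw [transpose_sub, transpose_one, Matrix.sub_mul, Matrix.mul_sub, Matrix.one_mul,
      Matrix.mul_one] at h1
    exact sub_right_injective h1
  have hH : (Eᵀ * A * E).IsSymm := by
    rw [Matrix.IsSymm, transpose_mul, transpose_mul, transpose_transpose, hAs, Matrix.mul_assoc]
  have hHq : ∀ v, v ⬝ᵥ ((Eᵀ * A * E) *ᵥ v) = (E *ᵥ v) ⬝ᵥ (A *ᵥ (E *ᵥ v)) := by
    intro v
    rw [Matrix.mul_assoc, ← mulVec_mulVec, dotProduct_mulVec, vecMul_transpose, mulVec_mulVec]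
  obtain ⟨μ, u, hu, hμu, hle⟩ := exists_top_eigenpair hA hH
  have hμ0 : 0 ≤ μ := by
    have h1 : 0 ≤ (E *ᵥ u) ⬝ᵥ (A *ᵥ (E *ᵥ u)) := by
      simpa using hA.posSemidef.dotProduct_mulVec_nonneg (E *ᵥ u)
    rw [← hHq, hμu, dotProduct_smul, smul_eq_mul] at h1
    exact nonneg_of_mul_nonneg_left h1 (hpos u hu)
  have hEE : E *ᵥ (E *ᵥ u) = μ • u := by
    apply mulVec_injective_of_det_ne_zero ((isUnit_iff_isUnit_det A).mp hA.isUnit).ne_zero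
    rw [mulVec_smul, ← hμu, hsymm]
    simp only [mulVec_mulVec, Matrix.mul_assoc]
  have hsr : Real.sqrt μ ≤ r := by
    by_cases hp : E *ᵥ u + Real.sqrt μ • u = 0
    · have := heig (-Real.sqrt μ) u hu (by rw [neg_smul]; exact eq_neg_of_add_eq_zero_left hp)
      rwa [abs_neg, abs_of_nonneg (Real.sqrt_nonneg μ)] at this
    · have := heig (Real.sqrt μ) _ hp (by
        rw [mulVec_add, mulVec_smul, hEE, smul_add, smul_smul, Real.mul_self_sqrt hμ0, add_comm])
      rwa [abs_of_nonneg (Real.sqrt_nonneg μ)] at this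
  rw [div_le_iff₀ (show 0 < enorm A w from Real.sqrt_pos.mpr (hpos w hw))]
  refine le_trans ?_ (mul_le_mul_of_nonneg_right hsr (Real.sqrt_nonneg _))
  rw [_root_.enorm, _root_.enorm, ← Real.sqrt_mul hμ0, ← hHq]
  exact Real.sqrt_le_sqrt (hle w)

end EnergyNorm

lemma quadForm_transpose_mul_mul {m k : Type*} [Fintype m] [Fintype k] (U : Matrix k m ℝ)
    (D : Matrix k k ℝ) (v : m → ℝ) :
    v ⬝ᵥ ((Uᵀ * D * U) *ᵥ v) = (U *ᵥ v) ⬝ᵥ (D *ᵥ (U *ᵥ v)) := by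
  rw [Matrix.mul_assoc, ← mulVec_mulVec, dotProduct_mulVec, vecMul_transpose, mulVec_mulVec]

lemma quadForm_le_of_symmetrized_le {m : Type*} [Fintype m] [DecidableEq m] {A M Q : Matrix m m ℝ}
    (hA : A.PosDef) (hM : IsUnit M.det) (hQs : Q.IsSymm) (hQ : Q * (M + Mᵀ - A) * Q = Q)
    {κ : ℝ} (hκ : 1 ≤ κ) (h : ∀ w, w ⬝ᵥ ((Mᵀ * Q * M) *ᵥ w) ≤ κ * (w ⬝ᵥ (A *ᵥ w))) (v : m → ℝ) :
    v ⬝ᵥ (((Mᵀ - A) * Q * (M - A)) *ᵥ v) ≤ (κ - 1) * (v ⬝ᵥ (A *ᵥ v)) := by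
  rcases isEmpty_or_nonempty m with hm | hm
  · simp [dotProduct]
  have hAs := isSymm_of_posDef hA
  have hH : ((Mᵀ - A) * Q * (M - A)).IsSymm := by
    simp only [Matrix.IsSymm, transpose_mul, transpose_sub, transpose_transpose, hAs.eq, hQs.eq,
      Matrix.mul_assoc]
  obtain ⟨μ, u, hu, hμu, hle⟩ := exists_top_eigenpair hA hH
  have hμκ : μ ≤ κ - 1 := by
    rcases eq_or_ne μ 0 with rfl | hμ
    · linarith
    obtain ⟨w, hw, hμw⟩ := exists_eigenpair_add_one ((isUnit_iff_isUnit_det A).mp hA.isUnit) hM hQ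
      hμ ⟨u, hu, hμu⟩
    have h1 := h w
    rw [hμw, dotProduct_smul, smul_eq_mul] at h1
    have hpos : 0 < w ⬝ᵥ (A *ᵥ w) := by simpa using hA.dotProduct_mulVec_pos hw
    have := le_of_mul_le_mul_right h1 hpos
    linarith
  have h0 : 0 ≤ v ⬝ᵥ (A *ᵥ v) := by simpa using hA.posSemidef.dotProduct_mulVec_nonneg v
  exact (hle v).trans (mul_le_mul_of_nonneg_right hμκ h0)

/-- The Sherman–Morrison–Woodbury form of the inexact two-grid preconditioner. -/
lemma twoGrid_preconditioner_mul {m k : Type*} [Fintype m] [DecidableEq m] [Fintype k]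
    [DecidableEq k] {A M : Matrix m m ℝ} {P : Matrix m k ℝ} {Bc D : Matrix k k ℝ}
    (hM : IsUnit M.det) (hN : IsUnit (M + Mᵀ - A).det) (hBc : IsUnit Bc.det) (hD : IsUnit D.det)
    (hDdef : D = Bc - Pᵀ * A * P + Pᵀ * (Mᵀ * (M + Mᵀ - A)⁻¹ * M) * P) :
    (M * (M + Mᵀ - A)⁻¹ * Mᵀ -
        ((Mᵀ - A) * (M + Mᵀ - A)⁻¹ * M * P) * D⁻¹ * (Pᵀ * Mᵀ * (M + Mᵀ - A)⁻¹ * (M - A))) *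
      (1 - (1 - Mᵀ⁻¹ * A) * (1 - P * Bc⁻¹ * Pᵀ * A) * (1 - M⁻¹ * A)) = A := by
  have hT := sub_mul_inv_mul_sub' hN
  obtain ⟨N, hNd⟩ : ∃ N, M + Mᵀ - A = N := ⟨_, rfl⟩
  rw [hNd] at hN hDdef hT ⊢
  have hMt : IsUnit Mᵀ.det := isUnit_det_transpose _ hM
  have h1 : Mᵀ - A = N - M := by rw [← hNd]; abel
  have h2 : M - A = N - Mᵀ := by rw [← hNd]; abel
  have hc1 : (Mᵀ - A) * N⁻¹ * M = M * N⁻¹ * (Mᵀ - A) := by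
    rw [h1, Matrix.sub_mul, Matrix.sub_mul, Matrix.mul_sub, mul_nonsing_inv _ hN,
      nonsing_inv_mul_cancel_right _ _ hN, Matrix.one_mul]
  have hc2 : Mᵀ * N⁻¹ * (M - A) = (M - A) * N⁻¹ * Mᵀ := by
    rw [h2, Matrix.sub_mul, Matrix.sub_mul, Matrix.mul_sub, mul_nonsing_inv _ hN,
      nonsing_inv_mul_cancel_right _ _ hN, Matrix.one_mul]
  obtain ⟨Z, hZ⟩ : ∃ Z, (1 - Mᵀ⁻¹ * A) * P = Z := ⟨_, rfl⟩
  obtain ⟨Zt, hZt⟩ : ∃ Zt, Pᵀ * (1 - A * M⁻¹) = Zt := ⟨_, rfl⟩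
  obtain ⟨Y, hY⟩ : ∃ Y, (Mᵀ - A) * N⁻¹ * M * P = Y := ⟨_, rfl⟩
  obtain ⟨Yt, hYt⟩ : ∃ Yt, Pᵀ * Mᵀ * N⁻¹ * (M - A) = Yt := ⟨_, rfl⟩
  have hS : Mᵀ * (1 - Mᵀ⁻¹ * A) = Mᵀ - A := by
    rw [Matrix.mul_sub, mul_nonsing_inv_cancel_left _ _ hMt, Matrix.mul_one]
  have hSt : (1 - A * M⁻¹) * M = M - A := by
    rw [Matrix.sub_mul, nonsing_inv_mul_cancel_right _ _ hM, Matrix.one_mul]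
  have hE : 1 - (1 - Mᵀ⁻¹ * A) * (1 - P * Bc⁻¹ * Pᵀ * A) * (1 - M⁻¹ * A) =
      (Mᵀ⁻¹ * N * M⁻¹ + Z * Bc⁻¹ * Zt) * A := by
    have h3 : 1 - (1 - Mᵀ⁻¹ * A) * (1 - M⁻¹ * A) = Mᵀ⁻¹ * N * M⁻¹ * A := by
      have h3' : Mᵀ⁻¹ * N * M⁻¹ = Mᵀ⁻¹ + M⁻¹ - Mᵀ⁻¹ * A * M⁻¹ := by
        rw [← hNd, Matrix.mul_sub, Matrix.mul_add, nonsing_inv_mul _ hMt, Matrix.sub_mul,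
          Matrix.add_mul, mul_nonsing_inv_cancel_right _ _ hM, Matrix.one_mul]
      rw [h3']
      simp only [Matrix.sub_mul, Matrix.add_mul, Matrix.mul_sub, Matrix.one_mul, Matrix.mul_one,
        Matrix.mul_assoc]
      abel
    have h4 : Zt * A = Pᵀ * A * (1 - M⁻¹ * A) := by
      rw [← hZt]
      simp only [Matrix.sub_mul, Matrix.mul_sub, Matrix.mul_one, Matrix.mul_assoc]
    rw [Matrix.add_mul, ← h3, Matrix.mul_assoc (Z * Bc⁻¹), h4, ← hZ, Matrix.mul_sub]
    simp only [Matrix.sub_mul, Matrix.mul_sub, Matrix.one_mul, Matrix.mul_one, Matrix.mul_assoc]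
    abel
  have hYZ : M * N⁻¹ * Mᵀ * Z = Y := by
    rw [← hZ, ← hY, hc1, ← hS]
    simp only [Matrix.mul_assoc]
  have hYZt : Yt * (Mᵀ⁻¹ * N * M⁻¹) = Zt := by
    rw [← hZt, ← hYt, Matrix.mul_assoc Pᵀ, Matrix.mul_assoc Pᵀ, hc2, ← hSt]
    simp only [Matrix.mul_assoc]
    rw [mul_nonsing_inv_cancel_left _ _ hMt, nonsing_inv_mul_cancel_left _ _ hN,
      mul_nonsing_inv _ hM, Matrix.mul_one]
  have hYtZ : Yt * Z = D - Bc := by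
    have h5 : Yt * Z = Pᵀ * ((M - A) * N⁻¹ * (Mᵀ - A)) * P := by
      rw [← hYt, ← hZ, Matrix.mul_assoc Pᵀ, Matrix.mul_assoc Pᵀ, hc2, ← hS]
      simp only [Matrix.mul_assoc]
    rw [h5, hT, hDdef, Matrix.mul_sub, Matrix.sub_mul]
    abel
  have hMM : M * N⁻¹ * Mᵀ * (Mᵀ⁻¹ * N * M⁻¹) = 1 := by
    simp only [Matrix.mul_assoc]
    rw [mul_nonsing_inv_cancel_left _ _ hMt, nonsing_inv_mul_cancel_left _ _ hN,
      mul_nonsing_inv _ hM]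
  rw [hE, hY, hYt, ← Matrix.mul_assoc]
  have hfin : (M * N⁻¹ * Mᵀ - Y * D⁻¹ * Yt) * (Mᵀ⁻¹ * N * M⁻¹ + Z * Bc⁻¹ * Zt) = 1 := by
    have h6 : Y * D⁻¹ * Yt * (Z * Bc⁻¹ * Zt) = Y * Bc⁻¹ * Zt - Y * D⁻¹ * Zt := by
      have h7 : Y * D⁻¹ * Yt * (Z * Bc⁻¹ * Zt) = Y * D⁻¹ * (Yt * Z) * Bc⁻¹ * Zt := by
        simp only [Matrix.mul_assoc]
      rw [h7, hYtZ, Matrix.mul_sub, nonsing_inv_mul_cancel_right _ _ hD, Matrix.sub_mul,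
        mul_nonsing_inv_cancel_right _ _ hBc, Matrix.sub_mul]
    rw [Matrix.mul_add, Matrix.sub_mul, Matrix.sub_mul, hMM, h6, Matrix.mul_assoc _ Yt, hYZt,
      ← Matrix.mul_assoc, ← Matrix.mul_assoc, hYZ]
    abel
  rw [hfin, Matrix.one_mul]

section CoarseProjector

variable {m k : Type*} [Fintype m] [DecidableEq m] [Fintype k] [DecidableEq k]
  {N : Matrix m m ℝ} {q : Matrix m k ℝ}

lemma coarseProjector_mul_mul_self (hN : IsUnit N.det) (hG : IsUnit (qᵀ * N⁻¹ * q).det) :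
    (N⁻¹ * q * (qᵀ * N⁻¹ * q)⁻¹ * qᵀ * N⁻¹) * N * (N⁻¹ * q * (qᵀ * N⁻¹ * q)⁻¹ * qᵀ * N⁻¹) =
      N⁻¹ * q * (qᵀ * N⁻¹ * q)⁻¹ * qᵀ * N⁻¹ := by
  obtain ⟨G, hGd⟩ : ∃ G, qᵀ * N⁻¹ * q = G := ⟨_, rfl⟩
  rw [hGd] at hG ⊢
  rw [nonsing_inv_mul_cancel_right _ _ hN]
  calc N⁻¹ * q * G⁻¹ * qᵀ * (N⁻¹ * q * G⁻¹ * qᵀ * N⁻¹)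
      = N⁻¹ * q * G⁻¹ * (qᵀ * N⁻¹ * q) * G⁻¹ * qᵀ * N⁻¹ := by simp only [Matrix.mul_assoc]
    _ = N⁻¹ * q * G⁻¹ * qᵀ * N⁻¹ := by rw [hGd, nonsing_inv_mul_cancel_right _ _ hG]

lemma compl_mul_mul_self {Q : Matrix m m ℝ} (hN : IsUnit N.det) (hQ : Q * N * Q = Q) :
    (N⁻¹ - Q) * N * (N⁻¹ - Q) = N⁻¹ - Q := by
  rw [Matrix.sub_mul, nonsing_inv_mul _ hN, Matrix.sub_mul, Matrix.one_mul, Matrix.mul_sub, hQ,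
    mul_nonsing_inv_cancel_right _ _ hN, sub_self, sub_zero]

end CoarseProjector

lemma quadForm_nonneg_of_mul_mul_self {m : Type*} [Fintype m] {N Q : Matrix m m ℝ}
    (hN : N.PosDef) (hQs : Q.IsSymm) (hQ : Q * N * Q = Q) (x : m → ℝ) : 0 ≤ x ⬝ᵥ (Q *ᵥ x) := by
  rw [← hQ]
  nth_rewrite 1 [← hQs.eq]
  rw [quadForm_transpose_mul_mul]
  simpa using hN.posSemidef.dotProduct_mulVec_nonneg (Q *ᵥ x)

lemma exists_ne_zero_mulVec_eq_zero {n k : ℕ} (h : k < n) (U : Matrix (Fin k) (Fin n) ℝ) :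
    ∃ v, v ≠ 0 ∧ U *ᵥ v = 0 := by
  have := LinearMap.ker_ne_bot_of_finrank_lt (f := U.mulVecLin) (by simpa using h)
  obtain ⟨v, hv, hv0⟩ := (Submodule.ne_bot_iff _).mp this
  exact ⟨v, hv0, by simpa using hv⟩

lemma mulVec_injective_of_rank_eq {n k : ℕ} {P : Matrix (Fin n) (Fin k) ℝ} (hP : P.rank = k) :
    Function.Injective P.mulVec := by
  rw [mulVec_injective_iff, linearIndependent_iff_card_eq_finrank_span, Fintype.card_fin, Set.finrank,
    ← rank_eq_finrank_span_cols, hP]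

theorem stmt_9 {n nc : ℕ} (hnc : nc < n)
    (A M : Matrix (Fin n) (Fin n) ℝ)
    (P : Matrix (Fin n) (Fin nc) ℝ)
    (Bc : Matrix (Fin nc) (Fin nc) ℝ)
    (hA : A.PosDef) (hM : IsUnit M.det)
    (hMMA : (M + Mᵀ - A).PosDef)
    (hP : P.rank = nc)
    (hBc : Bc.PosDef)
    (Ac : Matrix (Fin nc) (Fin nc) ℝ) (hAc : Ac = Pᵀ * A * P)
    (E : Matrix (Fin n) (Fin n) ℝ)
    (hE : E = (1 - Mᵀ⁻¹ * A) * (1 - P * Bc⁻¹ * Pᵀ * A) * (1 - M⁻¹ * A))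
    (Mtil : Matrix (Fin n) (Fin n) ℝ)
    (hMtil : Mtil = Mᵀ * (M + Mᵀ - A)⁻¹ * M)
    (Pi : Matrix (Fin n) (Fin n) ℝ) (hPi : Pi = P * (Pᵀ * Mtil * P)⁻¹ * Pᵀ * Mtil)
    (KTG : ℝ)
    (hK : IsGreatest {r : ℝ | ∃ v : Fin n → ℝ, v ≠ 0 ∧
        r = (enorm Mtil ((1 - Pi) *ᵥ v)) ^ 2 / (enorm A v) ^ 2} KTG)
    (lmaxD lminD : ℝ)
    (hlmaxD : IsGreatest (spectrum ℝ ((Pᵀ * Mtil * P)⁻¹ * (Bc - Ac))) lmaxD)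
    (hlminD : IsLeast (spectrum ℝ ((Pᵀ * Mtil * P)⁻¹ * (Bc - Ac))) lminD)
    (d₁ d₂ : ℝ) (hd₁ : d₁ = 1 / (1 + lmaxD)) (hd₂ : d₂ = 1 / (1 + lminD))
    (lamax lamin : ℝ)
    (hlamax : IsGreatest (spectrum ℝ (A⁻¹ * Mtil)) lamax)
    (hlamin : IsLeast (spectrum ℝ (A⁻¹ * Mtil)) lamin)
    (lbmax : ℝ) (hlbmax : IsGreatest (spectrum ℝ (A⁻¹ * Mtil * Pi)) lbmax)
    (normE : ℝ)
    (hnormE : IsGreatest {r : ℝ | ∃ v : Fin n → ℝ, v ≠ 0 ∧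
        r = enorm A (E *ᵥ v) / enorm A v} normE)
    (hcase₁ : 1 < d₁) (hcase₂ : d₁ ≤ d₂) (hcase₃ : d₂ < lbmax / (lbmax - 1)) :
    max (1 - 1 / max lamin (d₂ * KTG + (1 - d₂) * lamax))
        (1 / (min (lamax - d₁ * lbmax) ((1 - d₁) * lamin) + d₁) - 1) ≤ normE ∧
      normE ≤ max (1 - 1 / KTG) (1 / ((1 - d₂) * lbmax + d₂) - 1) := by
  have hA' : ∀ v : Fin n → ℝ, v ≠ 0 → 0 < v ⬝ᵥ (A *ᵥ v) := fun v hv => by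
    simpa using hA.dotProduct_mulVec_pos hv
  have hA0 : ∀ v : Fin n → ℝ, 0 ≤ v ⬝ᵥ (A *ᵥ v) := fun v => by
    simpa using hA.posSemidef.dotProduct_mulVec_nonneg v
  have hAdet := (isUnit_iff_isUnit_det A).mp hA.isUnit
  have hAs := isSymm_of_posDef hA
  have hNdet := (isUnit_iff_isUnit_det _).mp hMMA.isUnit
  have hNinv := hMMA.inv
  have hBdet := (isUnit_iff_isUnit_det Bc).mp hBc.isUnit
  have hn : Nonempty (Fin n) := ⟨⟨0, by omega⟩⟩
  have hPinj := mulVec_injective_of_rank_eq hP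
  have hMinj : Function.Injective M.mulVec := mulVec_injective_of_det_ne_zero hM.ne_zero
  have hbar := sub_mul_inv_mul_sub_s9 hNdet
  have htil := sub_mul_inv_mul_sub' hNdet
  have hspec := spectrum_inv_mul_symmetrized_comm hAdet hNdet
  have hinvBE := fun (D : Matrix (Fin nc) (Fin nc) ℝ) (hD : IsUnit D.det) h =>
    twoGrid_preconditioner_mul (P := P) hM hNdet hBdet hD h
  have hadd := fun (Q : Matrix (Fin n) (Fin n) ℝ) hQs hQ (κ : ℝ) hκ h =>
    quadForm_le_of_symmetrized_le (Q := Q) hA hM hQs hQ (κ := κ) hκ h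
  have hsub := fun (Q : Matrix (Fin n) (Fin n) ℝ) hQ (κ : ℝ) hκ hκ1 h =>
    exists_eigenpair_sub_one (Q := Q) (M := M) hAdet hQ (κ := κ) hκ hκ1 h
  obtain ⟨N, hN⟩ : ∃ N, M + Mᵀ - A = N := ⟨_, rfl⟩
  simp only [hN] at hMMA hMtil hNdet hNinv hbar htil hspec hinvBE hadd hsub
  have hNs := isSymm_of_posDef hNinv
  rw [← hMtil] at htil hspec
  -- the smoother
  have hTpd : Mtil.PosDef := by
    have := hNinv.conjTranspose_mul_mul_same hMinj
    rwa [conjTranspose_eq_transpose_of_trivial, ← hMtil] at this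
  have hTs := isSymm_of_posDef hTpd
  have hGpd : (Pᵀ * Mtil * P).PosDef := by
    have := hTpd.conjTranspose_mul_mul_same hPinj
    rwa [conjTranspose_eq_transpose_of_trivial] at this
  have hFt : (Mᵀ - A)ᵀ = M - A := by rw [transpose_sub, transpose_transpose, hAs.eq]
  have hFt' : (M - A)ᵀ = Mᵀ - A := by rw [transpose_sub, hAs.eq]
  have hFq : ∀ (Q : Matrix (Fin n) (Fin n) ℝ) v, v ⬝ᵥ (((Mᵀ - A) * Q * (M - A)) *ᵥ v) =
      ((M - A) *ᵥ v) ⬝ᵥ (Q *ᵥ ((M - A) *ᵥ v)) := fun Q v => by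
    rw [← hFt', quadForm_transpose_mul_mul]
  have hTA : ∀ v, v ⬝ᵥ (A *ᵥ v) ≤ v ⬝ᵥ (Mtil *ᵥ v) := by
    intro v
    have h1 : 0 ≤ v ⬝ᵥ ((Mtil - A) *ᵥ v) := by
      rw [← htil, ← hFt, quadForm_transpose_mul_mul]
      simpa using hNinv.posSemidef.dotProduct_mulVec_nonneg ((Mᵀ - A) *ᵥ v)
    rw [sub_mulVec, dotProduct_sub] at h1
    linarith
  have hbars : (M * N⁻¹ * Mᵀ).IsSymm := by
    simp only [Matrix.IsSymm, transpose_mul, transpose_transpose, hNs.eq, Matrix.mul_assoc]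
  have hm_upp := quadForm_le_of_isGreatest_spectrum hA hbars (hspec ▸ hlamax)
  have hm_low := le_quadForm_of_isLeast_spectrum hA hbars (hspec ▸ hlamin)
  have hlamin0 : 0 < lamin := by
    obtain ⟨v, hv, h⟩ := (mem_spectrum_inv_mul_iff hAdet).mp hlamin.1
    have h1 := hTA v
    rw [h, dotProduct_smul, smul_eq_mul] at h1
    exact pos_of_mul_pos_left ((hA' v hv).trans_le h1) (hA0 v)
  -- the coarse matrix
  obtain ⟨G, hG⟩ : ∃ G, Pᵀ * Mtil * P = G := ⟨_, rfl⟩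
  rw [hG] at hGpd hPi hlmaxD hlminD
  have hGdet := (isUnit_iff_isUnit_det G).mp hGpd.isUnit
  have hGis := isSymm_of_posDef hGpd.inv
  obtain ⟨D, hD⟩ : ∃ D, D = Bc - Pᵀ * A * P + G := ⟨_, rfl⟩
  have hDpd : D.PosDef := by
    have h1 : D = Bc + ((Mᵀ - A) * P)ᴴ * N⁻¹ * ((Mᵀ - A) * P) := by
      have h2 : ((Mᵀ - A) * P)ᴴ * N⁻¹ * ((Mᵀ - A) * P) = Pᵀ * (Mtil - A) * P := by
        rw [conjTranspose_eq_transpose_of_trivial, transpose_mul, hFt, ← htil]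
        simp only [Matrix.mul_assoc]
      rw [h2, hD, ← hG, Matrix.mul_sub, Matrix.sub_mul]
      abel
    rw [h1]
    exact hBc.add_posSemidef (hNinv.posSemidef.conjTranspose_mul_mul_same _)
  have hDdet := (isUnit_iff_isUnit_det D).mp hDpd.isUnit
  have hDis := isSymm_of_posDef hDpd.inv
  have hBE := hinvBE D hDdet (by rw [hD, ← hG, hMtil])
  rw [← hE] at hBE
  obtain ⟨U, hU⟩ : ∃ U, Pᵀ * Mᵀ * N⁻¹ * (M - A) = U := ⟨_, rfl⟩
  have hUt : (Mᵀ - A) * N⁻¹ * M * P = Uᵀ := by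
    rw [← hU]
    simp only [transpose_mul, transpose_transpose, hFt', hNs.eq, Matrix.mul_assoc]
  rw [hUt, hU] at hBE
  have hBcA : (Bc - Ac).IsSymm := by
    rw [Matrix.IsSymm, hAc, transpose_sub, (isSymm_of_posDef hBc).eq]
    simp only [transpose_mul, transpose_transpose, hAs.eq, Matrix.mul_assoc]
  have hd₁0 : 0 < d₁ := by linarith
  have hd₂0 : 0 < d₂ := by linarith
  have hl₁ : 0 < 1 + lmaxD := by rw [hd₁] at hd₁0; exact one_div_pos.mp hd₁0
  have hl₂ : 0 < 1 + lminD := by rw [hd₂] at hd₂0; exact one_div_pos.mp hd₂0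
  have hDq : ∀ u, u ⬝ᵥ (D *ᵥ u) = u ⬝ᵥ ((Bc - Ac) *ᵥ u) + u ⬝ᵥ (G *ᵥ u) := fun u => by
    rw [hD, add_mulVec, dotProduct_add, hAc]
  have hz₁ : ∀ z, d₁ * (z ⬝ᵥ (G⁻¹ *ᵥ z)) ≤ z ⬝ᵥ (D⁻¹ *ᵥ z) := by
    intro z
    have h := inv_quadForm_le_of_quadForm_le hDpd hGpd hl₁ (fun u => by
      have := quadForm_le_of_isGreatest_spectrum hGpd hBcA hlmaxD u
      rw [hDq]; linarith) z
    rw [hd₁, one_div_mul_eq_div, div_le_iff₀ hl₁]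
    linarith
  have hz₂ : ∀ z, z ⬝ᵥ (D⁻¹ *ᵥ z) ≤ d₂ * (z ⬝ᵥ (G⁻¹ *ᵥ z)) := by
    intro z
    refine inv_quadForm_le_of_quadForm_le hGpd hDpd hd₂0 (fun u => ?_) z
    have := le_quadForm_of_isLeast_spectrum hGpd hBcA hlminD u
    rw [hDq, hd₂, one_div_mul_eq_div, le_div_iff₀ hl₂]
    linarith
  -- the coarse projector
  have hqG : (M * P)ᵀ * N⁻¹ * (M * P) = G := by
    rw [← hG, hMtil, transpose_mul]
    simp only [Matrix.mul_assoc]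
  have hQp := coarseProjector_mul_mul_self (q := M * P) hNdet (by rwa [hqG])
  rw [hqG] at hQp
  obtain ⟨Q, hQ⟩ : ∃ Q, N⁻¹ * (M * P) * G⁻¹ * (M * P)ᵀ * N⁻¹ = Q := ⟨_, rfl⟩
  rw [hQ] at hQp
  have hQm := compl_mul_mul_self hNdet hQp
  have hQs : Q.IsSymm := by
    rw [← hQ]
    simp only [Matrix.IsSymm, transpose_mul, transpose_transpose, hNs.eq, hGis.eq, Matrix.mul_assoc]
  have hQms : (N⁻¹ - Q).IsSymm := hNs.sub hQs
  have hW : Mᵀ * Q * M = Mtil * Pi := by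
    rw [← hQ, hPi, hMtil, transpose_mul]
    simp only [Matrix.mul_assoc]
  have hWm : Mᵀ * (N⁻¹ - Q) * M = Mtil - Mtil * Pi := by
    rw [Matrix.mul_sub, Matrix.sub_mul, hW, ← hMtil]
  have hR : (Mᵀ - A) * Q * (M - A) = Uᵀ * G⁻¹ * U := by
    rw [← hUt, ← hU, ← hQ, transpose_mul]
    simp only [Matrix.mul_assoc]
  -- quadratic forms
  have hr : ∀ v, v ⬝ᵥ (((Mᵀ - A) * Q * (M - A)) *ᵥ v) = (U *ᵥ v) ⬝ᵥ (G⁻¹ *ᵥ (U *ᵥ v)) :=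
    fun v => by rw [hR, quadForm_transpose_mul_mul]
  have hmr : ∀ v, v ⬝ᵥ (((Mᵀ - A) * (N⁻¹ - Q) * (M - A)) *ᵥ v) = v ⬝ᵥ ((M * N⁻¹ * Mᵀ) *ᵥ v) -
      v ⬝ᵥ (A *ᵥ v) - (U *ᵥ v) ⬝ᵥ (G⁻¹ *ᵥ (U *ᵥ v)) := fun v => by
    have h1 : (Mᵀ - A) * (N⁻¹ - Q) * (M - A) =
        (Mᵀ - A) * N⁻¹ * (M - A) - (Mᵀ - A) * Q * (M - A) := by
      rw [Matrix.mul_sub (Mᵀ - A) N⁻¹ Q, Matrix.sub_mul ((Mᵀ - A) * N⁻¹)]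
    rw [← hr, h1, hbar]
    simp only [sub_mulVec, dotProduct_sub]
  obtain ⟨B, hB⟩ : ∃ B, M * N⁻¹ * Mᵀ - Uᵀ * D⁻¹ * U = B := ⟨_, rfl⟩
  rw [hB] at hBE
  have hBs : B.IsSymm := by
    rw [← hB]
    refine hbars.sub ?_
    simp only [Matrix.IsSymm, transpose_mul, transpose_transpose, hDis.eq, Matrix.mul_assoc]
  have hBq : ∀ v, v ⬝ᵥ (B *ᵥ v) = v ⬝ᵥ ((M * N⁻¹ * Mᵀ) *ᵥ v) -
      (U *ᵥ v) ⬝ᵥ (D⁻¹ *ᵥ (U *ᵥ v)) := fun v => by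
    rw [← hB, sub_mulVec, dotProduct_sub, quadForm_transpose_mul_mul]
  have hr0 : ∀ v, 0 ≤ (U *ᵥ v) ⬝ᵥ (G⁻¹ *ᵥ (U *ᵥ v)) := fun v => by
    simpa using hGpd.inv.posSemidef.dotProduct_mulVec_nonneg (U *ᵥ v)
  -- the coarse-space eigenvalue `lbmax`
  have hlb1 : 1 < lbmax := by
    by_contra! hle
    have h1 : lbmax / (lbmax - 1) ≤ 1 := by
      rcases hle.eq_or_lt with h | h
      · rw [h]; norm_num
      · rw [div_le_one_of_neg (by linarith)]; linarith
    linarith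
  have hα : 0 < (1 - d₂) * lbmax + d₂ := by
    rw [lt_div_iff₀ (by linarith)] at hcase₃
    linarith
  rw [Matrix.mul_assoc, ← hW] at hlbmax
  have hWs : (Mᵀ * Q * M).IsSymm := by
    simp only [Matrix.IsSymm, transpose_mul, transpose_transpose, hQs.eq, Matrix.mul_assoc]
  have hr_upp : ∀ v, (U *ᵥ v) ⬝ᵥ (G⁻¹ *ᵥ (U *ᵥ v)) ≤ (lbmax - 1) * (v ⬝ᵥ (A *ᵥ v)) := fun v => by
    rw [← hr]
    exact hadd Q hQs hQp lbmax hlb1.le (quadForm_le_of_isGreatest_spectrum hA hWs hlbmax) v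
  obtain ⟨vb, hvb, hvb_eq⟩ := hsub Q hQp lbmax (by linarith) hlb1.ne'
    ((mem_spectrum_inv_mul_iff hAdet).mp hlbmax.1)
  have hr_vb : (U *ᵥ vb) ⬝ᵥ (G⁻¹ *ᵥ (U *ᵥ vb)) = (lbmax - 1) * (vb ⬝ᵥ (A *ᵥ vb)) := by
    rw [← hr, hvb_eq, dotProduct_smul, smul_eq_mul]
  -- the exact two-grid constant `KTG`
  have hWms : (Mᵀ * (N⁻¹ - Q) * M).IsSymm := by
    simp only [Matrix.IsSymm, transpose_mul, transpose_transpose, hQms.eq, Matrix.mul_assoc]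
  have hPiT : (1 - Pi)ᵀ * Mtil * (1 - Pi) = Mᵀ * (N⁻¹ - Q) * M := by
    have h1 : Piᵀ * Mtil = Mtil * Pi := by
      rw [← hW, ← hWs.eq, hW, transpose_mul, hTs.eq]
    have h2 : Pi * Pi = Pi := by
      rw [hPi]
      calc P * G⁻¹ * Pᵀ * Mtil * (P * G⁻¹ * Pᵀ * Mtil)
          = P * G⁻¹ * (Pᵀ * Mtil * P) * G⁻¹ * Pᵀ * Mtil := by simp only [Matrix.mul_assoc]
        _ = P * G⁻¹ * Pᵀ * Mtil := by rw [hG, nonsing_inv_mul_cancel_right _ _ hGdet]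
    rw [hWm, transpose_sub, transpose_one, Matrix.sub_mul, Matrix.one_mul, h1, Matrix.mul_sub,
      Matrix.mul_one, Matrix.sub_mul, Matrix.mul_assoc, h2, sub_self, sub_zero]
  have hKr : ∀ v, (enorm Mtil ((1 - Pi) *ᵥ v)) ^ 2 / (enorm A v) ^ 2 =
      (v ⬝ᵥ ((Mᵀ * (N⁻¹ - Q) * M) *ᵥ v)) / (v ⬝ᵥ (A *ᵥ v)) := fun v => by
    rw [_root_.enorm, _root_.enorm, Real.sq_sqrt (hA0 v), Real.sq_sqrt, ← hPiT,
      quadForm_transpose_mul_mul]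
    simpa using hTpd.posSemidef.dotProduct_mulVec_nonneg ((1 - Pi) *ᵥ v)
  have hK_upp : ∀ v, v ⬝ᵥ ((Mᵀ * (N⁻¹ - Q) * M) *ᵥ v) ≤ KTG * (v ⬝ᵥ (A *ᵥ v)) := by
    intro v
    rcases eq_or_ne v 0 with rfl | hv
    · simp
    rw [← div_le_iff₀ (hA' v hv), ← hKr]
    exact hK.2 ⟨v, hv, rfl⟩
  have hK_eig : ∃ w, w ≠ 0 ∧ (Mᵀ * (N⁻¹ - Q) * M) *ᵥ w = KTG • (A *ᵥ w) := by
    obtain ⟨μ, w, hw, hμ, hle⟩ := exists_top_eigenpair hA hWms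
    obtain ⟨v₀, hv₀, hKv⟩ := hK.1
    have h1 : KTG ≤ μ := by
      rw [hKv, hKr, div_le_iff₀ (hA' v₀ hv₀)]
      exact hle v₀
    have h2 := hK_upp w
    rw [hμ, dotProduct_smul, smul_eq_mul] at h2
    have h3 := le_of_mul_le_mul_right h2 (hA' w hw)
    exact ⟨w, hw, by rw [hμ, le_antisymm h1 h3]⟩
  have hK1 : 1 ≤ KTG := by
    obtain ⟨v, hv, hv0⟩ := exists_ne_zero_mulVec_eq_zero hnc (Pᵀ * Mtil)
    have h1 := hK_upp v
    have h2 : Pi *ᵥ v = 0 := by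
      rw [hPi, Matrix.mul_assoc, ← mulVec_mulVec, hv0, mulVec_zero]
    rw [hWm, sub_mulVec, ← mulVec_mulVec, h2, mulVec_zero, sub_zero] at h1
    have h3 := (hTA v).trans h1
    exact le_of_mul_le_mul_right (by linarith) (hA' v hv)
  have hmr_upp : ∀ v, v ⬝ᵥ ((M * N⁻¹ * Mᵀ) *ᵥ v) - (U *ᵥ v) ⬝ᵥ (G⁻¹ *ᵥ (U *ᵥ v)) ≤
      KTG * (v ⬝ᵥ (A *ᵥ v)) := fun v => by
    have := hadd (N⁻¹ - Q) hQms hQm KTG hK1 hK_upp v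
    rw [hmr] at this
    linarith
  have hmr_low : ∀ v, v ⬝ᵥ (A *ᵥ v) ≤
      v ⬝ᵥ ((M * N⁻¹ * Mᵀ) *ᵥ v) - (U *ᵥ v) ⬝ᵥ (G⁻¹ *ᵥ (U *ᵥ v)) := fun v => by
    have h1 := hmr v
    rw [hFq] at h1
    have h2 := quadForm_nonneg_of_mul_mul_self hMMA hQms hQm ((M - A) *ᵥ v)
    linarith
  obtain ⟨vK, hvK, hmr_vK⟩ : ∃ v, v ≠ 0 ∧ KTG * (v ⬝ᵥ (A *ᵥ v)) ≤
      v ⬝ᵥ ((M * N⁻¹ * Mᵀ) *ᵥ v) - (U *ᵥ v) ⬝ᵥ (G⁻¹ *ᵥ (U *ᵥ v)) := by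
    rcases eq_or_ne KTG 1 with h | h
    · exact ⟨vb, hvb, by rw [h, one_mul]; exact hmr_low vb⟩
    obtain ⟨v, hv, hv_eq⟩ := hsub (N⁻¹ - Q) hQm KTG (by linarith) h hK_eig
    refine ⟨v, hv, ?_⟩
    have h1 := hmr v
    rw [hv_eq, dotProduct_smul, smul_eq_mul] at h1
    linarith
  -- a vector on which the exact two-grid method is exact
  obtain ⟨v1, hv1, hmr_v1⟩ : ∃ v, v ≠ 0 ∧
      v ⬝ᵥ ((M * N⁻¹ * Mᵀ) *ᵥ v) - (U *ᵥ v) ⬝ᵥ (G⁻¹ *ᵥ (U *ᵥ v)) ≤ v ⬝ᵥ (A *ᵥ v) := by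
    suffices h : ∃ v, v ≠ 0 ∧ (N⁻¹ - Q) *ᵥ ((M - A) *ᵥ v) = 0 by
      obtain ⟨v, hv, h0⟩ := h
      refine ⟨v, hv, ?_⟩
      have h1 := hmr v
      rw [hFq, h0, dotProduct_zero] at h1
      linarith
    by_cases hdet : (M - A).det = 0
    · obtain ⟨v, hv, h0⟩ := exists_mulVec_eq_zero_iff.mpr hdet
      exact ⟨v, hv, by rw [h0, mulVec_zero]⟩
    have hncpos : Nonempty (Fin nc) := by
      by_contra hne
      rw [not_nonempty_iff] at hne
      obtain ⟨v, hv, -⟩ := (mem_spectrum_inv_mul_iff hGdet).mp hlmaxD.1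
      exact hv (Subsingleton.elim _ _)
    obtain ⟨e, he⟩ := exists_ne (0 : Fin nc → ℝ)
    have hdet' : IsUnit (M - A).det := isUnit_iff_ne_zero.mpr hdet
    refine ⟨(M - A)⁻¹ *ᵥ (M *ᵥ (P *ᵥ e)), fun h0 => he ?_, ?_⟩
    · have h1 : M *ᵥ (P *ᵥ e) = 0 := by
        rw [← one_mulVec (M *ᵥ (P *ᵥ e)), ← mul_nonsing_inv _ hdet', ← mulVec_mulVec, h0,
          mulVec_zero]
      exact hPinj ((hMinj (h1.trans (mulVec_zero M).symm)).trans (mulVec_zero P).symm)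
    · have h1 : Q * (M * P) = N⁻¹ * (M * P) := by
        rw [← hQ]
        calc N⁻¹ * (M * P) * G⁻¹ * (M * P)ᵀ * N⁻¹ * (M * P)
            = N⁻¹ * (M * P) * G⁻¹ * ((M * P)ᵀ * N⁻¹ * (M * P)) := by simp only [Matrix.mul_assoc]
          _ = N⁻¹ * (M * P) := by rw [hqG, nonsing_inv_mul_cancel_right _ _ hGdet]
      rw [mulVec_mulVec (M *ᵥ _), mul_nonsing_inv _ hdet', one_mulVec, mulVec_mulVec, mulVec_mulVec,
        Matrix.mul_assoc, Matrix.sub_mul, h1, sub_self, zero_mulVec]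
  obtain ⟨v0, hv0, hU0⟩ := exists_ne_zero_mulVec_eq_zero hnc U
  -- bounds on the preconditioner
  have hB_upp : ∀ v, v ⬝ᵥ (B *ᵥ v) ≤ KTG * (v ⬝ᵥ (A *ᵥ v)) := fun v => by
    have h1 := hz₁ (U *ᵥ v)
    have h2 := hmr_upp v
    rw [hBq]
    nlinarith [hr0 v]
  have hB_low : ∀ v, ((1 - d₂) * lbmax + d₂) * (v ⬝ᵥ (A *ᵥ v)) ≤ v ⬝ᵥ (B *ᵥ v) := fun v => by
    have h1 := hz₂ (U *ᵥ v)
    have h2 := hmr_low v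
    have h3 := mul_le_mul_of_nonneg_left (hr_upp v) (show 0 ≤ d₂ - 1 by linarith)
    rw [hBq]
    linarith
  have hBpd : B.PosDef := by
    refine .of_dotProduct_mulVec_pos ?_ fun v hv => ?_
    · rw [IsHermitian, conjTranspose_eq_transpose_of_trivial, hBs.eq]
    · simpa using (mul_pos hα (hA' v hv)).trans_le (hB_low v)
  refine ⟨max_le ?_ ?_, energyNorm_le_of_quadForm_bounds hA hBs hBE hnormE.1 hα hB_low hB_upp⟩
  · have hx : 0 < max lamin (d₂ * KTG + (1 - d₂) * lamax) := lt_max_of_lt_left hlamin0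
    rcases max_choice lamin (d₂ * KTG + (1 - d₂) * lamax) with h | h <;> rw [h] at hx ⊢
    · refine one_sub_one_div_le_energyNorm hA hBpd hBE hnormE.2 hx hv0 ?_
      have h1 := hm_low v0
      rw [hBq, hU0]
      simpa using h1
    · refine one_sub_one_div_le_energyNorm hA hBpd hBE hnormE.2 hx hvK ?_
      have h1 := hz₂ (U *ᵥ vK)
      have h2 := mul_le_mul_of_nonneg_left hmr_vK hd₂0.le
      have h3 := mul_le_mul_of_nonneg_left (hm_upp vK) (show 0 ≤ d₂ - 1 by linarith)
      rw [hBq]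
      linarith
  · rcases min_choice (lamax - d₁ * lbmax) ((1 - d₁) * lamin) with h | h <;> rw [h]
    · refine one_div_sub_one_le_energyNorm hA hBpd hBE hnormE.2 hvb ?_
      have h1 := hz₁ (U *ᵥ vb)
      have h2 := hm_upp vb
      rw [hr_vb] at h1
      rw [hBq]
      linarith
    · refine one_div_sub_one_le_energyNorm hA hBpd hBE hnormE.2 hv1 ?_
      have h1 := hz₁ (U *ᵥ v1)
      have h2 := mul_le_mul_of_nonneg_left hmr_v1 hd₁0.le
      have h3 := mul_le_mul_of_nonneg_left (hm_low v1) (show 0 ≤ d₁ - 1 by linarith)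
      rw [hBq]
      linarith
end
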